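/- arXiv:2601.20249 — 2 statements merged into one kernel-verified Lean document; each statement's English description precedes it below -/
import Mathlib

section
/- Let H be a Hopf algebra over a field k with bijective antipode. The following are equivalent: (1) H is finite dimensional over k; (2) H is left (equivalently right) artinian; (3) Gpd_H(εk) = 0, or Gpd_{H^op}(k_ε) = 0 (i.e. the trivial left or right H-module is Gorenstein projective); (4) as a left (or right) H-module, k is a submodule of a projective module. -/
open TensorProduct

universe u

noncomputable section GorensteinCore

/-- `ProjDimLE R n M` : the left `R`-module `M` has a projective resolution of length `≤ n`. -/
def ProjDimLE (R : Type u) [Ring R] : ℕ → (M : Type u) → [AddCommGroup M] → [Module R M] → Prop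
  | 0, M, _, _ => Module.Projective R M
  | (n+1), M, _, _ => Module.Projective R M ∨
      ∃ (P : ModuleCat.{u} R) (f : P →ₗ[R] M), Module.Projective R P ∧
      Function.Surjective f ∧ ProjDimLE R n (LinearMap.ker f)

/-- The projective dimension of a module, as an element of `ℕ∞` (`⊤` = infinite). -/
def projDim (R : Type u) [Ring R] (M : Type u) [AddCommGroup M] [Module R M] : ℕ∞ :=
  sInf {n : ℕ∞ | ∃ m : ℕ, n = (m : ℕ∞) ∧ ProjDimLE R m M}

/-- A module is Gorenstein projective if it is a syzygy of a totally acyclic complex of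
projective modules. -/
def IsGorensteinProjective (R : Type u) [Ring R] (M : Type u) [AddCommGroup M] [Module R M] :
    Prop :=
  ∃ (P : ℤ → ModuleCat.{u} R) (d : ∀ i : ℤ, P (i+1) →ₗ[R] P i),
    (∀ i, Module.Projective R (P i)) ∧
    (∀ i, LinearMap.range (d (i+1)) = LinearMap.ker (d i)) ∧
    (∀ (Q : ModuleCat.{u} R), Module.Projective R Q →
      ∀ (i : ℤ) (f : P (i+1) →ₗ[R] Q), f.comp (d (i+1)) = 0 →
        ∃ g : P i →ₗ[R] Q, g.comp (d i) = f) ∧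
    Nonempty (M ≃ₗ[R] LinearMap.ker (d 0))

/-- `GProjDimLE R n M` : `M` has a Gorenstein projective resolution of length `≤ n`. -/
def GProjDimLE (R : Type u) [Ring R] : ℕ → (M : Type u) → [AddCommGroup M] → [Module R M] → Prop
  | 0, M, _, _ => IsGorensteinProjective R M
  | (n+1), M, _, _ => IsGorensteinProjective R M ∨
      ∃ (G : ModuleCat.{u} R) (f : G →ₗ[R] M), IsGorensteinProjective R G ∧
      Function.Surjective f ∧ GProjDimLE R n (LinearMap.ker f)

/-- The Gorenstein projective dimension of a module, as an element of `ℕ∞`. -/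
def gProjDim (R : Type u) [Ring R] (M : Type u) [AddCommGroup M] [Module R M] : ℕ∞ :=
  sInf {n : ℕ∞ | ∃ m : ℕ, n = (m : ℕ∞) ∧ GProjDimLE R m M}

/-- The (left) Gorenstein global dimension of a ring `R`. -/
def lGgldim (R : Type u) [Ring R] : ℕ∞ :=
  ⨆ M : ModuleCat.{u} R, gProjDim R M

/-- The (left) global dimension of a ring `R`. -/
def lgldim (R : Type u) [Ring R] : ℕ∞ :=
  ⨆ M : ModuleCat.{u} R, projDim R M

/-- `InjDimLE R n M` : the left `R`-module `M` has an injective resolution of length `≤ n`. -/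
def InjDimLE (R : Type u) [Ring R] : ℕ → (M : Type u) → [AddCommGroup M] → [Module R M] → Prop
  | 0, M, _, _ => Module.Injective R M
  | (n+1), M, _, _ => Module.Injective R M ∨
      ∃ (I : ModuleCat.{u} R) (f : M →ₗ[R] I), Module.Injective R I ∧
      Function.Injective f ∧ InjDimLE R n (I ⧸ LinearMap.range f)

/-- The injective dimension of a module, as an element of `ℕ∞`. -/
def injDim (R : Type u) [Ring R] (M : Type u) [AddCommGroup M] [Module R M] : ℕ∞ :=
  sInf {n : ℕ∞ | ∃ m : ℕ, n = (m : ℕ∞) ∧ InjDimLE R m M}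

/-- `silp R` : the supremum of the injective dimensions of projective left `R`-modules. -/
def silp (R : Type u) [Ring R] : ℕ∞ :=
  ⨆ (M : ModuleCat.{u} R) (_ : Module.Projective R M), injDim R M

/-- `spli R` : the supremum of the projective dimensions of injective left `R`-modules. -/
def spli (R : Type u) [Ring R] : ℕ∞ :=
  ⨆ (M : ModuleCat.{u} R) (_ : Module.Injective R M), projDim R M

end GorensteinCore
noncomputable section HopfCore

variable (k : Type u) [CommRing k] (H : Type u) [Ring H] [HopfAlgebra k H]

/-- The trivial left `H`-module structure on `k`, given by the counit. -/
def trivModule : Module H k :=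
  Module.compHom k ((Bialgebra.counitAlgHom k H : H →ₐ[k] k) : H →+* k)

/-- The trivial left `H`-module `εk`, as an object of `ModuleCat H`. -/
def trivMod : ModuleCat.{u} H :=
  @ModuleCat.of H _ k _ (trivModule k H)

/-- The counit of `H`, as a ring homomorphism out of `Hᵐᵒᵖ`. -/
def counitOp : Hᵐᵒᵖ →+* k :=
  RingHom.fromOpposite ((Bialgebra.counitAlgHom k H : H →ₐ[k] k) : H →+* k)
    (fun _ _ => mul_comm _ _)

/-- The trivial right `H`-module structure on `k` (as a left `Hᵐᵒᵖ`-module). -/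
def trivModuleOp : Module Hᵐᵒᵖ k :=
  Module.compHom k (counitOp k H)

/-- The trivial right `H`-module `k_ε`, as an object of `ModuleCat Hᵐᵒᵖ`. -/
def trivModOp : ModuleCat.{u} Hᵐᵒᵖ :=
  @ModuleCat.of Hᵐᵒᵖ _ k _ (trivModuleOp k H)

section TensorAction

variable (M N : Type u) [AddCommGroup M] [Module k M] [Module H M]
  [IsScalarTower k H M] [SMulCommClass k H M]
  [AddCommGroup N] [Module k N] [Module H N] [IsScalarTower k H N] [SMulCommClass k H N]

/-- The representation of `H` on a left `H`-module `M`, as an algebra morphism to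
`End_k(M)`. -/
def hRep : H →ₐ[k] Module.End k M :=
  (Algebra.lsmul k k M : H →ₐ[k] Module.End k M)

/-- The representation of `H` on `M ⊗[k] N` given by the comultiplication of `H`:
`h • (m ⊗ n) = ∑ h₁ • m ⊗ h₂ • n`. -/
def tensorRep : H →ₐ[k] Module.End k (M ⊗[k] N) :=
  ((Module.endTensorEndAlgHom (R := k) (S := k) (A := k) (M := M) (N := N)).comp
    (Algebra.TensorProduct.map (hRep k H M) (hRep k H N))).comp
    (Bialgebra.comulAlgHom k H)

/-- The diagonal left `H`-module structure on `M ⊗[k] N`: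
`h • (m ⊗ n) = ∑ h₁ • m ⊗ h₂ • n`. -/
def tensorModule : Module H (M ⊗[k] N) :=
  Module.compHom (M ⊗[k] N)
    ((tensorRep k H M N).toRingHom : H →+* Module.End k (M ⊗[k] N))

/-- The tensor product `M ⊗[k] N` with its diagonal left `H`-module structure, as an
object of `ModuleCat H`. -/
def tensorMod : ModuleCat.{u} H :=
  @ModuleCat.of H _ (M ⊗[k] N) _ (tensorModule k H M N)

end TensorAction

end HopfCore

section

open Coalgebra HopfAlgebra

variable {k : Type u} [Field k] {H : Type u} [Ring H] [HopfAlgebra k H]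

theorem sum_antipode_mul_tmul (h : H) :
    ((LinearMap.mul' k H ∘ₗ (antipode k).rTensor H).rTensor H)
      ((TensorProduct.assoc k H H H).symm (comul.lTensor H (comul h))) = 1 ⊗ₜ[k] h := by
  rw [Coalgebra.coassoc_symm_apply, ← LinearMap.comp_apply, ← LinearMap.rTensor_comp,
    LinearMap.comp_assoc, mul_antipode_rTensor_comul, LinearMap.rTensor_comp,
    LinearMap.comp_apply, Coalgebra.rTensor_counit_comul]
  simp

theorem rTensor_mul_antipode_assoc_symm (x : H) (z : H ⊗[k] H) :
    ((LinearMap.mul' k H ∘ₗ (antipode k).rTensor H).rTensor H)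
      ((TensorProduct.assoc k H H H).symm (x ⊗ₜ z)) = (antipode k x ⊗ₜ[k] 1) * z := by
  induction z with
  | zero => simp
  | add a b ha hb => simp only [tmul_add, map_add, ha, hb, mul_add]
  | tmul a b => simp

theorem one_tmul_mul_comul (h : H) : ∃ (n : ℕ) (x y : Fin n → H), ∀ v : H,
    (1 ⊗ₜ[k] h) * comul v = ∑ i, (antipode k (x i) ⊗ₜ[k] 1) * comul (y i * v) := by
  obtain ⟨n, x, y, hxy⟩ := TensorProduct.exists_sum_tmul_eq (comul (R := k) h)
  refine ⟨n, x, y, fun v => ?_⟩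
  rw [← sum_antipode_mul_tmul, hxy]
  simp only [map_sum, LinearMap.lTensor_tmul, rTensor_mul_antipode_assoc_symm, Finset.sum_mul,
    mul_assoc, Bialgebra.comul_mul]

/-- A bijective antipode as a linear equivalence. -/
noncomputable def antipodeEquiv (hS : Function.Bijective (antipode k (A := H))) : H ≃ₗ[k] H :=
  LinearEquiv.ofBijective _ hS

theorem antipode_antipodeEquiv_symm (hS : Function.Bijective (antipode k (A := H))) (a : H) :
    antipode k ((antipodeEquiv hS).symm a) = a :=
  (antipodeEquiv hS).apply_symm_apply a

theorem mul_antipode_inv (hS : Function.Bijective (antipode k (A := H))) :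
    LinearMap.mul' k H ∘ₗ ((antipodeEquiv hS).symm.toLinearMap).lTensor H ∘ₗ
      (TensorProduct.comm k H H).toLinearMap ∘ₗ comul = Algebra.linearMap k H ∘ₗ counit := by
  ext a
  apply hS.1
  have h1 : antipode k ∘ₗ LinearMap.mul' k H ∘ₗ
      ((antipodeEquiv hS).symm.toLinearMap).lTensor H ∘ₗ (TensorProduct.comm k H H).toLinearMap
      = LinearMap.mul' k H ∘ₗ (antipode k).lTensor H := by
    ext x y
    simp [antipode_mul_antidistrib, antipode_antipodeEquiv_symm]
  have := LinearMap.congr_fun h1 (comul a)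
  simp only [LinearMap.comp_apply] at this ⊢
  rw [this, mul_antipode_lTensor_comul_apply]
  simp [Algebra.algebraMap_eq_smul_one]

theorem antipode_inv_mul (hS : Function.Bijective (antipode k (A := H))) :
    LinearMap.mul' k H ∘ₗ ((antipodeEquiv hS).symm.toLinearMap).rTensor H ∘ₗ
      (TensorProduct.comm k H H).toLinearMap ∘ₗ comul = Algebra.linearMap k H ∘ₗ counit := by
  ext a
  apply hS.1
  have h1 : antipode k ∘ₗ LinearMap.mul' k H ∘ₗ
      ((antipodeEquiv hS).symm.toLinearMap).rTensor H ∘ₗ (TensorProduct.comm k H H).toLinearMap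
      = LinearMap.mul' k H ∘ₗ (antipode k).rTensor H := by
    ext x y
    simp [antipode_mul_antidistrib, antipode_antipodeEquiv_symm]
  have := LinearMap.congr_fun h1 (comul a)
  simp only [LinearMap.comp_apply] at this ⊢
  rw [this, mul_antipode_rTensor_comul_apply]
  simp [Algebra.algebraMap_eq_smul_one]

theorem eq_zero_of_one_tmul_mul_comul (hS : Function.Bijective (antipode k (A := H))) {h v : H}
    (hv : v ≠ 0) (hh : (1 ⊗ₜ[k] h) * comul (R := k) v = 0) : h = 0 := by
  set T : H ⊗[k] H →ₗ[k] H := LinearMap.mul' k H ∘ₗ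
    ((antipodeEquiv hS).symm.toLinearMap).lTensor H ∘ₗ (TensorProduct.comm k H H).toLinearMap
    with hT
  have key : T.lTensor H ∘ₗ (TensorProduct.assoc k H H H).toLinearMap ∘ₗ
      (comul (R := k) (A := H)).rTensor H ∘ₗ LinearMap.mulLeft k ((1 : H) ⊗ₜ[k] h) =
      (LinearMap.mulLeft k h ∘ₗ T).lTensor H ∘ₗ (TensorProduct.assoc k H H H).toLinearMap ∘ₗ
      (comul (R := k) (A := H)).rTensor H := by
    ext x y
    simp only [AlgebraTensorModule.curry_apply, LinearMap.restrictScalars_self, curry_apply,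
      LinearMap.comp_apply, LinearMap.mulLeft_apply, Algebra.TensorProduct.tmul_mul_tmul, one_mul,
      LinearMap.rTensor_tmul, LinearEquiv.coe_coe]
    induction comul (R := k) x with
    | zero => simp
    | add a b ha hb => simp only [add_tmul, map_add, ha, hb]
    | tmul a b => simp [hT, mul_assoc]
  have h2 := LinearMap.congr_fun key (comul v)
  simp only [LinearMap.comp_apply, LinearMap.mulLeft_apply, hh, map_zero, LinearEquiv.coe_coe,
    Coalgebra.coassoc_apply] at h2
  rw [← LinearMap.comp_apply, ← LinearMap.lTensor_comp, LinearMap.comp_assoc, hT,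
    LinearMap.comp_assoc, LinearMap.comp_assoc, mul_antipode_inv hS, LinearMap.lTensor_comp,
    LinearMap.comp_apply, LinearMap.lTensor_comp, LinearMap.comp_apply,
    Coalgebra.lTensor_counit_comul] at h2
  simp only [LinearMap.lTensor_tmul, Algebra.linearMap_apply, map_one, LinearMap.mulLeft_apply,
    mul_one] at h2
  by_contra hne
  obtain ⟨f, hf⟩ := not_forall.1 (mt (Module.forall_dual_apply_eq_zero_iff k v).1 hv)
  have h3 := congrArg (TensorProduct.lid k H ∘ f.rTensor H) h2
  simp only [Function.comp_apply, map_zero, LinearMap.rTensor_tmul, lid_tmul] at h3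
  exact smul_ne_zero hf hne h3.symm

/-- A Hopf algebra with bijective antipode and a nonzero finite dimensional left ideal is finite
dimensional. -/
theorem finite_of_finite_leftIdeal (hS : Function.Bijective (antipode k (A := H)))
    (V : Submodule k H) [Module.Finite k V] (hV : ∀ h, ∀ v ∈ V, h * v ∈ V) (hne : V ≠ ⊥) :
    Module.Finite k H := by
  obtain ⟨v, hvV, hv⟩ := V.exists_mem_ne_zero_of_ne_bot hne
  obtain ⟨s, hs⟩ := (Module.Finite.iff_fg.1 ‹Module.Finite k V›)
  obtain ⟨A, B, hA, hB, hAB⟩ := TensorProduct.exists_finite_submodule_of_setFinite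
    (comul (R := k) '' (s : Set H)) (s.finite_toSet.image _)
  obtain ⟨C, hAC, hBC, hC⟩ : ∃ C : Submodule k H, A ≤ C ∧ B ≤ C ∧ Module.Finite k C := by
    refine ⟨A ⊔ B, le_sup_left, le_sup_right, ?_⟩
    rw [Module.Finite.iff_fg] at *
    exact hA.sup hB
  obtain ⟨q, hq⟩ := LinearMap.exists_leftInverse_of_injective C.subtype C.ker_subtype
  have hqC : ∀ c ∈ C, (q c : H) = c := fun c hc =>
    congrArg Subtype.val (LinearMap.congr_fun hq ⟨c, hc⟩)
  set p : H →ₗ[k] H := C.subtype ∘ₗ q with hp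
  have hpp : ∀ w ∈ V, p.rTensor H (comul w) = comul w ∧ p.lTensor H (comul w) = comul w := by
    have hle : V ≤ LinearMap.eqLocus (p.rTensor H ∘ₗ comul) comul ⊓
        LinearMap.eqLocus (p.lTensor H ∘ₗ comul) comul := by
      rw [← hs, Submodule.span_le]
      intro w hw
      obtain ⟨z, hz⟩ := hAB ⟨w, hw, rfl⟩
      have : ∀ z : A ⊗[k] B, p.rTensor H (mapIncl A B z) = mapIncl A B z ∧
          p.lTensor H (mapIncl A B z) = mapIncl A B z := by
        intro z
        induction z with
        | zero => simp
        | add a b ha hb => simp [ha, hb]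
        | tmul a b =>
          have ha := hqC a (hAC a.2)
          have hb := hqC b (hBC b.2)
          simp [mapIncl, hp, ha, hb]
      have := this z
      rw [hz] at this
      simpa using this
    intro w hw
    simpa using hle hw
  let φ : H →ₗ[k] C ⊗[k] C := TensorProduct.map q q ∘ₗ
    LinearMap.mulRight k (comul (R := k) v) ∘ₗ TensorProduct.mk k H H 1
  let b := Module.finBasis k C
  let e := (b.tensorProduct b).equivFun
  refine Module.Finite.of_injective (e.toLinearMap ∘ₗ φ)
    ((injective_iff_map_eq_zero _).2 fun h hh => ?_)
  replace hh : φ h = 0 := e.map_eq_zero_iff.1 hh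
  refine eq_zero_of_one_tmul_mul_comul hS hv ?_
  have h1 : p.rTensor H ((1 ⊗ₜ[k] h) * comul v) = (1 ⊗ₜ[k] h) * comul v := by
    conv_rhs => rw [← (hpp v hvV).1]
    induction comul (R := k) v with
    | zero => simp
    | add a b ha hb => simp only [mul_add, map_add, ha, hb]
    | tmul a b => simp
  have h2 : p.lTensor H ((1 ⊗ₜ[k] h) * comul v) = (1 ⊗ₜ[k] h) * comul v := by
    obtain ⟨n, x, y, hxy⟩ := one_tmul_mul_comul (k := k) h
    have h3 : ∀ (a : H) (z : H ⊗[k] H), p.lTensor H ((a ⊗ₜ 1) * z) = (a ⊗ₜ 1) * p.lTensor H z := by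
      intro a z
      induction z with
      | zero => simp
      | add a b ha hb => simp only [mul_add, map_add, ha, hb]
      | tmul a b => simp
    rw [hxy, map_sum]
    exact Finset.sum_congr rfl fun i _ => by rw [h3, (hpp _ (hV _ _ hvV)).2]
  rw [← h2, ← h1, ← LinearMap.comp_apply, LinearMap.lTensor_comp_rTensor, hp,
    TensorProduct.map_comp, LinearMap.comp_apply]
  simp only [φ, LinearMap.comp_apply, LinearMap.mulRight_apply, TensorProduct.mk_apply] at hh
  rw [hh, map_zero]

end

section

open Coalgebra HopfAlgebra

variable {k : Type u} [Field k] {H : Type u} [Ring H] [HopfAlgebra k H]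

/-- The opposite bialgebra. -/
@[reducible]
noncomputable def opBialgebra (k H : Type u) [Field k] [Ring H] [Bialgebra k H] :
    Bialgebra k Hᵐᵒᵖ :=
  Bialgebra.mk' k Hᵐᵒᵖ (by simp [MulOpposite.counit_def])
    (by simp [MulOpposite.counit_def, mul_comm])
    (by simp [MulOpposite.comul_def, Algebra.TensorProduct.one_def])
    (fun {a b} => by
      simp only [MulOpposite.comul_def, LinearMap.comp_apply, LinearEquiv.coe_coe,
        MulOpposite.coe_opLinearEquiv_symm, MulOpposite.unop_mul, Bialgebra.comul_mul]
      generalize comul (R := k) (MulOpposite.unop a) = x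
      generalize comul (R := k) (MulOpposite.unop b) = y
      induction x with
      | zero => simp
      | add x₁ x₂ h₁ h₂ => simp only [mul_add, map_add, add_mul, h₁, h₂]
      | tmul x₁ x₂ =>
        induction y with
        | zero => simp
        | add y₁ y₂ h₁ h₂ => simp only [mul_add, map_add, add_mul, h₁, h₂]
        | tmul y₁ y₂ => simp)

/-- The opposite of a Hopf algebra with bijective antipode; its antipode is the inverse of the
original one. -/
@[reducible]
noncomputable def opHopfAlgebra (hS : Function.Bijective (antipode k (A := H))) :
    HopfAlgebra k Hᵐᵒᵖ where
  __ := opBialgebra k H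
  antipode := (MulOpposite.opLinearEquiv k).toLinearMap ∘ₗ (antipodeEquiv hS).symm.toLinearMap ∘ₗ
    (MulOpposite.opLinearEquiv k).symm.toLinearMap
  mul_antipode_rTensor_comul := by
    refine LinearMap.ext fun a => ?_
    have h := congrArg MulOpposite.op
      (LinearMap.congr_fun (mul_antipode_inv hS) (MulOpposite.unop a))
    simp only [LinearMap.comp_apply] at h
    refine Eq.trans ?_ h
    change LinearMap.mul' k Hᵐᵒᵖ (LinearMap.rTensor _ _ (comul (R := k) a)) = _
    simp only [MulOpposite.comul_def, LinearMap.comp_apply, LinearEquiv.coe_coe,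
        MulOpposite.coe_opLinearEquiv_symm]
    generalize comul (R := k) (MulOpposite.unop a) = x
    induction x with
    | zero => simp
    | add x₁ x₂ h₁ h₂ => simp only [map_add, MulOpposite.op_add, h₁, h₂]
    | tmul x₁ x₂ => simp
  mul_antipode_lTensor_comul := by
    refine LinearMap.ext fun a => ?_
    have h := congrArg MulOpposite.op
      (LinearMap.congr_fun (antipode_inv_mul hS) (MulOpposite.unop a))
    simp only [LinearMap.comp_apply] at h
    refine Eq.trans ?_ h
    change LinearMap.mul' k Hᵐᵒᵖ (LinearMap.lTensor _ _ (comul (R := k) a)) = _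
    simp only [MulOpposite.comul_def, LinearMap.comp_apply, LinearEquiv.coe_coe,
        MulOpposite.coe_opLinearEquiv_symm]
    generalize comul (R := k) (MulOpposite.unop a) = x
    induction x with
    | zero => simp
    | add x₁ x₂ h₁ h₂ => simp only [map_add, MulOpposite.op_add, h₁, h₂]
    | tmul x₁ x₂ => simp

theorem bijective_antipode_opHopfAlgebra (hS : Function.Bijective (antipode k (A := H))) :
    Function.Bijective (@HopfAlgebra.antipode k Hᵐᵒᵖ _ _ (opHopfAlgebra hS).toHopfAlgebraStruct) :=
  (((MulOpposite.opLinearEquiv k).symm.trans (antipodeEquiv hS).symm).trans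
    (MulOpposite.opLinearEquiv k)).bijective

/-- The antipode as an isomorphism onto the opposite ring. -/
noncomputable def antipodeRingEquiv (hS : Function.Bijective (antipode k (A := H))) : H ≃+* Hᵐᵒᵖ :=
  RingEquiv.ofBijective (antipodeAlgHomOp k H) ((MulOpposite.opEquiv.bijective).comp hS)

/-- If the trivial module embeds into a projective module, there is a nonzero left integral. -/
theorem exists_ne_zero_mul_eq_counit_smul {P : Type u} [AddCommGroup P] [Module H P]
    [Module.Projective H P] (ι : trivMod k H →ₗ[H] P) (hι : Function.Injective ι) :
    ∃ t : H, t ≠ 0 ∧ ∀ h : H, h * t = counit (R := k) h • t := by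
  obtain ⟨s, hs⟩ := Module.projective_def.1 ‹Module.Projective H P›
  let f := s ∘ₗ ι
  have hf : Function.Injective f := hs.injective.comp hι
  let e : trivMod k H := (1 : k)
  have he : e ≠ 0 := one_ne_zero (α := k)
  have hfe : f e ≠ 0 := fun h => he (hf (h.trans (map_zero f).symm))
  obtain ⟨i, hi⟩ := Finsupp.ne_iff.1 hfe
  refine ⟨f e i, hi, fun h => ?_⟩
  have h1 : h • e = (algebraMap k H (counit h)) • e := by
    change counit (R := k) h * 1 = counit (R := k) (algebraMap k H (counit h)) * 1
    simp
  have h2 := DFunLike.congr_fun (congrArg f h1) i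
  rw [map_smul, map_smul, Finsupp.smul_apply, Finsupp.smul_apply, smul_eq_mul, smul_eq_mul,
    ← Algebra.smul_def] at h2
  exact h2

theorem finite_of_trivMod_embeds (hS : Function.Bijective (antipode k (A := H)))
    {P : Type u} [AddCommGroup P] [Module H P]
    [Module.Projective H P] (ι : trivMod k H →ₗ[H] P) (hι : Function.Injective ι) :
    Module.Finite k H := by
  obtain ⟨t, ht, h⟩ := exists_ne_zero_mul_eq_counit_smul ι hι
  refine finite_of_finite_leftIdeal hS (Submodule.span k {t}) (fun h' v hv => ?_) (by simpa)
  obtain ⟨c, rfl⟩ := Submodule.mem_span_singleton.1 hv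
  rw [mul_smul_comm, h]
  exact Submodule.smul_mem _ _ (Submodule.smul_mem _ _ (Submodule.mem_span_singleton_self t))

end

theorem gProjDim_eq_zero_iff {R : Type u} [Ring R] {M : Type u} [AddCommGroup M] [Module R M] :
    gProjDim R M = 0 ↔ IsGorensteinProjective R M := by
  constructor
  · intro h
    have hne : {n : ℕ∞ | ∃ m : ℕ, n = (m : ℕ∞) ∧ GProjDimLE R m M}.Nonempty := by
      by_contra hemp
      rw [Set.not_nonempty_iff_eq_empty] at hemp
      simp [gProjDim, hemp] at h
    obtain ⟨m, hm, hM⟩ := csInf_mem hne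
    rw [gProjDim] at h
    rw [h] at hm
    obtain rfl : m = 0 := by exact_mod_cast hm.symm
    exact hM
  · intro h
    exact le_antisymm (sInf_le ⟨0, rfl, h⟩) bot_le

theorem IsGorensteinProjective.exists_embedding {R : Type u} [Ring R] {M : Type u}
    [AddCommGroup M] [Module R M] (h : IsGorensteinProjective R M) :
    ∃ (P : ModuleCat.{u} R) (ι : M →ₗ[R] P), Module.Projective R P ∧ Function.Injective ι := by
  obtain ⟨P, d, hP, -, -, ⟨e⟩⟩ := h
  exact ⟨P (0 + 1), (LinearMap.ker (d 0)).subtype ∘ₗ e.toLinearMap, hP _,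
    (Submodule.injective_subtype _).comp e.injective⟩

section artinian

variable {k : Type u} [Field k] {A : Type u} [Ring A] [Algebra k A]

/-- A subspace of an algebra as a left ideal. -/
def Submodule.toLeftIdeal (X : Submodule k A) (hX : ⊤ * X ≤ X) : Ideal A where
  __ := X
  smul_mem' _ _ hx := hX (Submodule.mul_mem_mul Submodule.mem_top hx)

/-- A subspace of an algebra as a right ideal. -/
def Submodule.toRightIdeal (X : Submodule k A) (hX : X * ⊤ ≤ X) : Ideal Aᵐᵒᵖ where
  carrier := {a | a.unop ∈ X}
  add_mem' := X.add_mem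
  zero_mem' := X.zero_mem
  smul_mem' _ _ hx := hX (Submodule.mul_mem_mul hx Submodule.mem_top)

theorem Submodule.mem_toLeftIdeal {X : Submodule k A} {hX : ⊤ * X ≤ X} {a : A} :
    a ∈ X.toLeftIdeal hX ↔ a ∈ X := Iff.rfl

theorem Submodule.mem_toRightIdeal {X : Submodule k A} {hX : X * ⊤ ≤ X} {a : Aᵐᵒᵖ} :
    a ∈ X.toRightIdeal hX ↔ a.unop ∈ X := Iff.rfl

theorem Submodule.top_mul_top : (⊤ * ⊤ : Submodule k A) = ⊤ :=
  top_le_iff.1 fun a _ => mul_one a ▸ mul_mem_mul mem_top mem_top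

theorem Submodule.le_top_mul (X : Submodule k A) : X ≤ ⊤ * X :=
  fun a ha => one_mul a ▸ mul_mem_mul mem_top ha

theorem Submodule.le_mul_top (X : Submodule k A) : X ≤ X * ⊤ :=
  fun a ha => mul_one a ▸ mul_mem_mul ha mem_top

theorem exists_fg_top_mul_eq [IsNoetherianRing A] {X : Submodule k A} (hX : ⊤ * X ≤ X) :
    ∃ F : Submodule k A, F.FG ∧ F ≤ X ∧ ⊤ * F = X := by
  obtain ⟨s, hs⟩ := IsNoetherian.noetherian (X.toLeftIdeal hX)
  have hsX : Submodule.span k (s : Set A) ≤ X :=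
    Submodule.span_le.2 fun a ha => by
      have : a ∈ X.toLeftIdeal hX := hs ▸ Submodule.subset_span ha
      exact this
  refine ⟨Submodule.span k s, ⟨s, rfl⟩, hsX, le_antisymm ((mul_le_mul_right hsX _).trans hX) ?_⟩
  have hF : ⊤ * (⊤ * Submodule.span k (s : Set A)) ≤ ⊤ * Submodule.span k (s : Set A) := by
    rw [← mul_assoc, Submodule.top_mul_top]
  have : X.toLeftIdeal hX ≤ (⊤ * Submodule.span k (s : Set A)).toLeftIdeal hF := by
    rw [← hs, Submodule.span_le]
    exact fun a ha => Submodule.mem_toLeftIdeal.2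
      (Submodule.le_top_mul _ (Submodule.subset_span ha))
  exact fun a ha => Submodule.mem_toLeftIdeal.1 (this (Submodule.mem_toLeftIdeal.2 ha))

theorem exists_fg_mul_top_eq [IsNoetherianRing Aᵐᵒᵖ] {X : Submodule k A} (hX : X * ⊤ ≤ X) :
    ∃ F : Submodule k A, F.FG ∧ F ≤ X ∧ F * ⊤ = X := by
  classical
  obtain ⟨s, hs⟩ := IsNoetherian.noetherian (X.toRightIdeal hX)
  let t := s.image MulOpposite.unop
  have hsX : Submodule.span k (t : Set A) ≤ X :=
    Submodule.span_le.2 fun a ha => by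
      obtain ⟨b, hb, rfl⟩ := Finset.mem_image.1 ha
      have : b ∈ X.toRightIdeal hX := hs ▸ Submodule.subset_span hb
      exact this
  refine ⟨Submodule.span k t, ⟨t, rfl⟩, hsX, le_antisymm ((mul_le_mul_left hsX _).trans hX) ?_⟩
  have hF : (Submodule.span k (t : Set A) * ⊤) * ⊤ ≤ Submodule.span k (t : Set A) * ⊤ := by
    rw [mul_assoc, Submodule.top_mul_top]
  have : X.toRightIdeal hX ≤ (Submodule.span k (t : Set A) * ⊤).toRightIdeal hF := by
    rw [← hs, Submodule.span_le]
    exact fun a ha => Submodule.mem_toRightIdeal.2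
      (Submodule.le_mul_top _ (Submodule.subset_span (Finset.mem_image_of_mem _ ha)))
  exact fun a ha => Submodule.mem_toRightIdeal.1
    (this (show MulOpposite.op a ∈ X.toRightIdeal hX from ha))

theorem exists_fg_sup_eq_top {X : Submodule k A} (hX : X.CoFG) :
    ∃ W : Submodule k A, W.FG ∧ X ⊔ W = ⊤ := by
  obtain ⟨W, hW⟩ := X.exists_isCompl
  exact ⟨W, hX.fg_of_isCompl hW, hW.sup_eq_top⟩

theorem cofg_comap {X V : Submodule k A} (hV : V.FG) {f : A →ₗ[k] A}
    (hf : LinearMap.range f ≤ X ⊔ V) : (X.comap f).CoFG := by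
  rw [← X.ker_mkQ, ← LinearMap.ker_comp, ← Submodule.range_fg_iff_ker_cofg, LinearMap.range_comp]
  refine Submodule.FG.of_le (hV.map X.mkQ) ?_
  refine (Submodule.map_mono hf).trans ?_
  simp [Submodule.map_sup]

/-- The predicate saying that a subspace of an algebra is a two-sided ideal of finite
codimension. -/
structure IsCofiniteIdeal (X : Submodule k A) : Prop where
  top_mul_le : ⊤ * X ≤ X
  mul_top_le : X * ⊤ ≤ X
  cofg : X.CoFG

theorem IsCofiniteIdeal.inf {X Y : Submodule k A} (hX : IsCofiniteIdeal X)
    (hY : IsCofiniteIdeal Y) : IsCofiniteIdeal (X ⊓ Y) where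
  top_mul_le := le_inf ((mul_le_mul_right inf_le_left _).trans hX.top_mul_le)
    ((mul_le_mul_right inf_le_right _).trans hY.top_mul_le)
  mul_top_le := le_inf ((mul_le_mul_left inf_le_left _).trans hX.mul_top_le)
    ((mul_le_mul_left inf_le_right _).trans hY.mul_top_le)
  cofg := hX.cofg.inf hY.cofg

theorem isCofiniteIdeal_top : IsCofiniteIdeal (⊤ : Submodule k A) := ⟨le_top, le_top, .top⟩

theorem exists_least_isCofiniteIdeal [IsArtinianRing A] :
    ∃ N : Submodule k A, IsCofiniteIdeal N ∧ ∀ X : Submodule k A, IsCofiniteIdeal X → N ≤ X := by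
  obtain ⟨I, hI, hmin⟩ := IsArtinian.set_has_minimal
    {I : Ideal A | IsCofiniteIdeal (I.restrictScalars k)} ⟨⊤, isCofiniteIdeal_top⟩
  refine ⟨I.restrictScalars k, hI, fun X hX => ?_⟩
  have h1 := hmin (I ⊓ X.toLeftIdeal hX.top_mul_le) (hI.inf hX)
  have h2 : I ⊓ X.toLeftIdeal hX.top_mul_le = I := eq_of_le_of_not_lt inf_le_left h1
  exact fun a ha => (inf_eq_left.1 h2 ha :)

theorem mul_self_of_least [IsNoetherianRing A] {N : Submodule k A} (hN : IsCofiniteIdeal N)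
    (hmin : ∀ X : Submodule k A, IsCofiniteIdeal X → N ≤ X) : N * N = N := by
  refine le_antisymm ((mul_le_mul_left le_top _).trans hN.top_mul_le) (hmin _ ⟨?_, ?_, ?_⟩)
  · rw [← mul_assoc]
    exact mul_le_mul_left hN.top_mul_le _
  · rw [mul_assoc]
    exact mul_le_mul_right hN.mul_top_le _
  · obtain ⟨W, hW, hNW⟩ := exists_fg_sup_eq_top hN.cofg
    obtain ⟨F, hF, hFN, hFe⟩ := exists_fg_top_mul_eq hN.top_mul_le
    refine (Submodule.FG.sup (hW.mul hF) hW).cofg_of_codisjoint (codisjoint_iff.2 ?_)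
    refine top_le_iff.1 ?_
    calc ⊤ = (N ⊔ W) * F ⊔ W := by rw [hNW, hFe, hNW]
      _ ≤ W * F ⊔ W ⊔ N * N := by
        rw [Submodule.sup_mul]
        exact sup_le (sup_le (le_sup_of_le_right (mul_le_mul_right hFN _))
          (le_sup_of_le_left le_sup_left)) (le_sup_of_le_left le_sup_right)

theorem mul_le_of_mul_le_of_least [IsNoetherianRing A] {N : Submodule k A} (hN : IsCofiniteIdeal N)
    (hmin : ∀ X : Submodule k A, IsCofiniteIdeal X → N ≤ X) {X Y : Submodule k A}
    (hX : ⊤ * X ≤ X) (hX' : X * ⊤ ≤ X) (hY : Y * ⊤ ≤ Y) (h : N * X ≤ Y) :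
    X * N ≤ Y := by
  obtain ⟨W, hW, hNW⟩ := exists_fg_sup_eq_top hN.cofg
  obtain ⟨F, hF, hFX, hFe⟩ := exists_fg_top_mul_eq hX
  have hV : (W * F).FG := hW.mul hF
  have hXV : X ≤ Y ⊔ W * F := by
    rw [← hFe, ← hNW, Submodule.sup_mul]
    exact sup_le_sup_right ((mul_le_mul_right hFX _).trans h) _
  have hVX : W * F ≤ X := (mul_le_mul' le_top hFX).trans hX
  obtain ⟨s, hs⟩ := hV
  let L : Submodule k A := sInf (Set.image (fun v => Y.comap (LinearMap.mulLeft k v)) s)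
  have hL : ∀ {a}, a ∈ L ↔ ∀ x ∈ X, x * a ∈ Y := by
    intro a
    constructor
    · intro ha x hx
      have h1 : W * F ≤ Y.comap (LinearMap.mulRight k a) := by
        rw [← hs, Submodule.span_le]
        intro v hv
        exact Submodule.mem_sInf.1 ha _ ⟨v, hv, rfl⟩
      obtain ⟨y, hy, v, hv, rfl⟩ := Submodule.mem_sup.1 (hXV hx)
      rw [add_mul]
      exact add_mem (hY (Submodule.mul_mem_mul hy Submodule.mem_top)) (h1 hv)
    · intro ha
      refine Submodule.mem_sInf.2 ?_
      rintro _ ⟨v, hv, rfl⟩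
      exact ha v (hVX (hs ▸ Submodule.subset_span hv))
  have hLc : IsCofiniteIdeal L := by
    refine ⟨?_, ?_, ?_⟩
    · refine Submodule.mul_le.2 fun b _ a ha => hL.2 fun x hx => ?_
      rw [← mul_assoc]
      exact hL.1 ha _ (hX' (Submodule.mul_mem_mul hx Submodule.mem_top))
    · refine Submodule.mul_le.2 fun a ha b _ => hL.2 fun x hx => ?_
      rw [← mul_assoc]
      exact hY (Submodule.mul_mem_mul (hL.1 ha x hx) Submodule.mem_top)
    · refine Submodule.CoFG.sInf_of_finite (s.finite_toSet.image _) ?_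
      rintro _ ⟨v, hv, rfl⟩
      refine cofg_comap (hW.mul hF) (le_trans ?_ hXV)
      rintro _ ⟨a, rfl⟩
      exact hX' (Submodule.mul_mem_mul (hVX (hs ▸ Submodule.subset_span hv)) Submodule.mem_top)
  exact Submodule.mul_le.2 fun x hx a ha => hL.1 (hmin L hLc ha) x hx

theorem mul_le_mul_of_least [IsNoetherianRing A] {N : Submodule k A} (hN : IsCofiniteIdeal N)
    (hmin : ∀ X : Submodule k A, IsCofiniteIdeal X → N ≤ X) {C : Submodule k A}
    (hC : ⊤ * C ≤ C) (hC' : C * ⊤ ≤ C) : C * N ≤ N * C := by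
  have h1 : (N ⊓ C) * N ≤ N * C := by
    refine mul_le_of_mul_le_of_least hN hmin ?_ ?_ ?_ (mul_le_mul_right inf_le_right _)
    · exact le_inf ((mul_le_mul_right inf_le_left _).trans hN.top_mul_le)
        ((mul_le_mul_right inf_le_right _).trans hC)
    · exact le_inf ((mul_le_mul_left inf_le_left _).trans hN.mul_top_le)
        ((mul_le_mul_left inf_le_right _).trans hC')
    · rw [mul_assoc]
      exact mul_le_mul_right hC' _
  calc C * N = C * N * N := by rw [mul_assoc, mul_self_of_least hN hmin]
    _ ≤ (N ⊓ C) * N := mul_le_mul_left (le_inf ((mul_le_mul_left le_top _).trans hN.top_mul_le)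
        ((mul_le_mul_right le_top _).trans hC')) _
    _ ≤ N * C := h1

theorem pow_succ_mul_pow_succ_le {N C : Submodule k A} (h : C * N ≤ N * C) (n : ℕ) :
    C ^ (n + 1) * N ^ (n + 1) ≤ (N * C) ^ (n + 1) := by
  have h1 : ∀ n, C ^ n * N ≤ N * C ^ n := by
    intro n
    induction n with
    | zero => simp
    | succ n ih =>
      calc C ^ (n + 1) * N = C ^ n * (C * N) := by rw [pow_succ, mul_assoc]
        _ ≤ C ^ n * (N * C) := mul_le_mul_right h _
        _ = C ^ n * N * C := by rw [mul_assoc]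
        _ ≤ N * C ^ n * C := mul_le_mul_left ih _
        _ = N * C ^ (n + 1) := by rw [pow_succ, mul_assoc]
  induction n with
  | zero => simpa using h
  | succ n ih =>
    calc C ^ (n + 1 + 1) * N ^ (n + 1 + 1) = C * (C ^ (n + 1) * N) * N ^ (n + 1) := by
          rw [pow_succ' C, pow_succ' N]; simp only [mul_assoc]
      _ ≤ C * (N * C ^ (n + 1)) * N ^ (n + 1) :=
          mul_le_mul_left (mul_le_mul_right (h1 _) _) _
      _ = C * N * (C ^ (n + 1) * N ^ (n + 1)) := by simp only [mul_assoc]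
      _ ≤ N * C * (N * C) ^ (n + 1) := mul_le_mul' h ih
      _ = (N * C) ^ (n + 1 + 1) := (pow_succ' (N * C) _).symm

/-- An algebra which is left artinian, right noetherian and has a proper two-sided ideal of finite
codimension has a nonzero finite dimensional left ideal. -/
theorem exists_finite_leftIdeal [IsArtinianRing A] [IsNoetherianRing Aᵐᵒᵖ] {M : Submodule k A}
    (hM : IsCofiniteIdeal M) (hMt : M ≠ ⊤) :
    ∃ G : Submodule k A, G.FG ∧ ⊤ * G ≤ G ∧ G ≠ ⊥ := by
  obtain ⟨N, hN, hmin⟩ := exists_least_isCofiniteIdeal (k := k) (A := A)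
  have hNt : N ≠ ⊤ := fun h => hMt (top_le_iff.1 (h ▸ hmin M hM))
  have hNN := mul_self_of_least hN hmin
  let J : Submodule k A := (Ring.jacobson A).restrictScalars k
  let C : Submodule k A :=
    { carrier := {a | ∀ x ∈ N, x * a ∈ J}
      add_mem' := fun {a b} ha hb x hx => by rw [mul_add]; exact J.add_mem (ha x hx) (hb x hx)
      zero_mem' := fun x _ => by rw [mul_zero]; exact J.zero_mem
      smul_mem' := fun c a ha x hx => by rw [mul_smul_comm]; exact J.smul_mem c (ha x hx) }
  have hNC : N * C ≤ J := Submodule.mul_le.2 fun x hx a ha => ha x hx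
  have hCl : ⊤ * C ≤ C := Submodule.mul_le.2 fun b _ a ha x hx => by
    rw [← mul_assoc]
    exact ha _ (hN.mul_top_le (Submodule.mul_mem_mul hx Submodule.mem_top))
  have hCr : C * ⊤ ≤ C := Submodule.mul_le.2 fun a ha b _ x hx => by
    rw [← mul_assoc]
    exact (Ring.jacobson A).mul_mem_right b (ha x hx)
  have hCN : N ⊔ C = ⊤ := by
    let N' : Submodule A (A ⧸ Ring.jacobson A) :=
      Submodule.map (Ring.jacobson A).mkQ (N.toLeftIdeal hN.top_mul_le)
    let q : (A ⧸ Ring.jacobson A) →ₛₗ[Ideal.Quotient.mk (Ring.jacobson A)]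
        (A ⧸ Ring.jacobson A) :=
      { toFun := id
        map_add' := fun _ _ => rfl
        map_smul' := fun a x => by
          obtain ⟨x, rfl⟩ := Ideal.Quotient.mk_surjective x
          rfl }
    have : IsSemisimpleModule A (A ⧸ Ring.jacobson A) :=
      (q.isSemisimpleModule_iff_of_bijective Function.bijective_id).2 inferInstance
    obtain ⟨D, hD⟩ := exists_isCompl N'
    have hDC : ∀ d, (Ring.jacobson A).mkQ d ∈ D → d ∈ C := by
      intro d hd x hx
      refine (Submodule.Quotient.mk_eq_zero _).1 ?_
      refine (Submodule.disjoint_def.1 hD.disjoint) ((Ring.jacobson A).mkQ (x * d)) ?_ ?_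
      · exact Submodule.mem_map_of_mem (Submodule.mem_toLeftIdeal.2
          (hN.mul_top_le (Submodule.mul_mem_mul hx Submodule.mem_top)))
      · rw [← smul_eq_mul, map_smul]
        exact D.smul_mem _ hd
    refine top_le_iff.1 fun a _ => ?_
    have ha : (Ring.jacobson A).mkQ a ∈ N' ⊔ D := hD.sup_eq_top ▸ Submodule.mem_top
    obtain ⟨_, ⟨x, hx, rfl⟩, y, hy, hxy⟩ := Submodule.mem_sup.1 ha
    refine Submodule.mem_sup.2 ⟨x, hx, a - x, hDC _ ?_, add_sub_cancel _ _⟩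
    rw [map_sub, ← hxy, add_sub_cancel_left]
    exact hy
  obtain ⟨n, hn⟩ : ∃ n, J ^ (n + 1) = ⊥ := by
    obtain ⟨n, hn⟩ := IsSemiprimaryRing.isNilpotent (R := A)
    have hle : ∀ m, J ^ (m + 1) ≤ ((Ring.jacobson A) ^ (m + 1)).restrictScalars k := by
      intro m
      induction m with
      | zero => rw [zero_add, pow_one, Submodule.pow_one]
      | succ m ih =>
        rw [pow_succ J, Submodule.pow_succ]
        exact Submodule.mul_le.2 fun a ha b hb => Ideal.mul_mem_mul (ih ha) hb
    refine ⟨n, le_bot_iff.1 ((hle n).trans ?_)⟩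
    intro a ha
    rw [Submodule.restrictScalars_mem, Submodule.pow_succ, hn, zero_mul] at ha
    exact ha
  have hGN : C ^ (n + 1) * N = ⊥ := by
    have := pow_succ_mul_pow_succ_le (mul_le_mul_of_least hN hmin hCl hCr) n
    rw [(show IsIdempotentElem N from hNN).pow_succ_eq] at this
    exact le_bot_iff.1 (this.trans ((pow_le_pow_left' hNC _).trans hn.le))
  have hCNn : ∀ n, N ⊔ C ^ (n + 1) = ⊤ := by
    intro n
    induction n with
    | zero => simpa using hCN
    | succ n ih =>
      refine top_le_iff.1 ?_
      calc ⊤ = (N ⊔ C ^ (n + 1)) * (N ⊔ C) := by rw [ih, hCN, Submodule.top_mul_top]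
        _ ≤ _ := by
          rw [Submodule.sup_mul, Submodule.mul_sup (C ^ (n + 1)), pow_succ C (n + 1)]
          refine sup_le (le_sup_of_le_left ((mul_le_mul_right le_top _).trans hN.mul_top_le))
            (sup_le_sup_right ((mul_le_mul_left le_top _).trans hN.top_mul_le) _)
  refine ⟨C ^ (n + 1), ?_, ?_, ?_⟩
  · have : C ^ (n + 1) * ⊤ ≤ C ^ (n + 1) := by
      rw [pow_succ, mul_assoc]
      exact mul_le_mul_right hCr _
    obtain ⟨F, hF, hFC, hFe⟩ := exists_fg_mul_top_eq this
    obtain ⟨W, hW, hNW⟩ := exists_fg_sup_eq_top hN.cofg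
    have : C ^ (n + 1) = F * W := by
      rw [← hFe, ← hNW, Submodule.mul_sup,
        le_bot_iff.1 ((mul_le_mul_left hFC N).trans hGN.le), bot_sup_eq]
    rw [this]
    exact hF.mul hW
  · rw [pow_succ', ← mul_assoc]
    exact mul_le_mul_left hCl _
  · intro h
    have := hCNn n
    rw [h, sup_bot_eq] at this
    exact hNt this

end artinian

section

open Coalgebra HopfAlgebra

variable {k : Type u} [Field k] {H : Type u} [Ring H] [HopfAlgebra k H]

theorem isCofiniteIdeal_ker_counit {k H : Type u} [Field k] [Ring H] [Bialgebra k H] :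
    IsCofiniteIdeal (LinearMap.ker (counit (R := k) (A := H))) where
  top_mul_le := Submodule.mul_le.2 fun a _ b hb => by
    rw [LinearMap.mem_ker] at hb
    simp [hb]
  mul_top_le := Submodule.mul_le.2 fun a ha b _ => by
    rw [LinearMap.mem_ker] at ha
    simp [ha]
  cofg := Submodule.CoFG.ker _

theorem finite_of_isArtinianRing (hS : Function.Bijective (antipode k (A := H)))
    [IsArtinianRing H] : Module.Finite k H := by
  have : IsArtinianRing Hᵐᵒᵖ := (antipodeRingEquiv hS).isArtinianRing
  have hne : LinearMap.ker (counit (R := k) (A := H)) ≠ ⊤ := fun h => by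
    have : (1 : H) ∈ LinearMap.ker (counit (R := k) (A := H)) := h ▸ Submodule.mem_top
    simp at this
  obtain ⟨G, hG, hGl, hG0⟩ := exists_finite_leftIdeal isCofiniteIdeal_ker_counit hne
  have := Module.Finite.iff_fg.2 hG
  exact finite_of_finite_leftIdeal hS G
    (fun h v hv => hGl (Submodule.mul_mem_mul Submodule.mem_top hv)) hG0

theorem finite_iff_isArtinian (hS : Function.Bijective (antipode k (A := H))) :
    Module.Finite k H ↔ IsArtinian H H :=
  ⟨fun _ => isArtinian_of_tower k inferInstance, fun _ => finite_of_isArtinianRing hS⟩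

end

section

open Coalgebra HopfAlgebra

variable {k : Type u} [Field k] {H : Type u} [Ring H] [HopfAlgebra k H]

/-- The map `φ ⊗ a ↦ (y ↦ (id ⊗ φ) (Δ (y * a)))`. -/
noncomputable def dualTensorCoind (k H : Type u) [Field k] [Ring H] [HopfAlgebra k H] :
    Module.Dual k H ⊗[k] H →ₗ[k] (H →ₗ[k] H) :=
  TensorProduct.lift <| LinearMap.mk₂ k
    (fun φ a => (TensorProduct.rid k H).toLinearMap ∘ₗ φ.lTensor H ∘ₗ comul ∘ₗ
      LinearMap.mulRight k a)
    (fun φ ψ a => by ext; simp [LinearMap.lTensor_add])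
    (fun c φ a => by ext; simp [LinearMap.lTensor_smul])
    (fun φ a b => by ext; simp [mul_add])
    (fun c φ a => by ext; simp)

theorem dualTensorCoind_tmul (φ : Module.Dual k H) (a y : H) :
    dualTensorCoind k H (φ ⊗ₜ a) y = TensorProduct.rid k H (φ.lTensor H (comul (y * a))) := rfl

/-- The map `p ⊗ s ↦ φ (· * s) ⊗ p`. -/
noncomputable def dualTensorAct (φ : Module.Dual k H) : H ⊗[k] H →ₗ[k] Module.Dual k H ⊗[k] H :=
  (LinearMap.rTensor H (LinearMap.llcomp k H H k φ ∘ₗ (LinearMap.mul k H).flip)) ∘ₗ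
    (TensorProduct.comm k H H).toLinearMap

theorem dualTensorAct_tmul (φ : Module.Dual k H) (p s : H) :
    dualTensorAct φ (p ⊗ₜ s) = (φ ∘ₗ LinearMap.mulRight k s) ⊗ₜ p := rfl

/-- The map `φ ⊗ a ↦ φ (· * S a₂) ⊗ a₁`. -/
noncomputable def dualTensorUnact (k H : Type u) [Field k] [Ring H] [HopfAlgebra k H] :
    Module.Dual k H ⊗[k] H →ₗ[k] Module.Dual k H ⊗[k] H :=
  TensorProduct.lift <| LinearMap.mk₂ k
    (fun φ a => dualTensorAct φ ((antipode k).lTensor H (comul a)))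
    (fun φ ψ a => by simp [dualTensorAct, LinearMap.add_comp, LinearMap.rTensor_add])
    (fun c φ a => by simp [dualTensorAct, LinearMap.smul_comp, LinearMap.rTensor_smul])
    (fun φ a b => by simp)
    (fun c φ a => by simp)

theorem dualTensorUnact_tmul (φ : Module.Dual k H) (a : H) :
    dualTensorUnact k H (φ ⊗ₜ a) = dualTensorAct φ ((antipode k).lTensor H (comul a)) := rfl

theorem dualTensorUnact_dualTensorAct (φ : Module.Dual k H) (a : H) :
    dualTensorUnact k H (dualTensorAct φ (comul a)) = φ ⊗ₜ a := by
  have h1 : dualTensorUnact k H ∘ₗ dualTensorAct φ = dualTensorAct φ ∘ₗ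
      (LinearMap.mul' k H ∘ₗ (antipode k).rTensor H).lTensor H ∘ₗ
      (TensorProduct.assoc k H H H).toLinearMap ∘ₗ comul.rTensor H := by
    ext x y : 3
    simp only [AlgebraTensorModule.curry_apply, LinearMap.restrictScalars_self, curry_apply,
      LinearMap.comp_apply, dualTensorAct_tmul, dualTensorUnact_tmul, LinearMap.rTensor_tmul,
      LinearEquiv.coe_coe]
    induction comul (R := k) x with
    | zero => simp
    | add a b ha hb => simp only [map_add, add_tmul, ha, hb]
    | tmul p q =>
      simp only [LinearMap.lTensor_tmul, dualTensorAct_tmul, assoc_tmul, LinearMap.comp_apply,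
        LinearMap.rTensor_tmul, LinearMap.mul'_apply]
      congr 1
      ext z
      simp [mul_assoc]
  have h2 := LinearMap.congr_fun h1 (comul a)
  simp only [LinearMap.comp_apply, LinearEquiv.coe_coe, Coalgebra.coassoc_apply] at h2
  rw [h2, ← LinearMap.comp_apply (LinearMap.lTensor H _), ← LinearMap.lTensor_comp,
    LinearMap.comp_assoc, mul_antipode_rTensor_comul, LinearMap.lTensor_comp, LinearMap.comp_apply,
    Coalgebra.lTensor_counit_comul]
  simp [dualTensorAct_tmul]

theorem injective_dualTensorCoind [Module.Finite k H] :
    Function.Injective (dualTensorCoind k H) := by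
  let T : Module.Dual k H ⊗[k] H →ₗ[k] Module.Dual k H ⊗[k] H :=
    TensorProduct.lift <| LinearMap.mk₂ k (fun φ a => dualTensorAct φ (comul a))
    (fun φ ψ a => by simp [dualTensorAct, LinearMap.add_comp, LinearMap.rTensor_add])
    (fun c φ a => by simp [dualTensorAct, LinearMap.smul_comp, LinearMap.rTensor_smul])
    (fun φ a b => by simp)
    (fun c φ a => by simp)
  have hT : dualTensorUnact k H ∘ₗ T = LinearMap.id :=
    TensorProduct.ext' fun φ a => dualTensorUnact_dualTensorAct φ a
  have hTi : Function.Injective T := fun a b hab => by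
    rw [← LinearMap.id_apply (R := k) a, ← LinearMap.id_apply (R := k) b, ← hT,
      LinearMap.comp_apply, hab, LinearMap.comp_apply]
  refine (injective_iff_map_eq_zero _).2 fun z hz => ?_
  suffices h0 : T z = 0 from hTi (h0.trans (LinearMap.map_zero T).symm)
  refine (dualTensorHomEquiv k H H).map_eq_zero_iff.1 ?_
  ext h
  obtain ⟨n, x, y, hxy⟩ := one_tmul_mul_comul (k := k) h
  have key : ∀ z, dualTensorHomEquiv k H H (T z) h =
      ∑ i, antipode k (x i) * dualTensorCoind k H z (y i) := by
    intro z
    induction z with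
    | zero => simp
    | add a b ha hb => simp only [map_add, LinearMap.add_apply, ha, hb, mul_add,
        Finset.sum_add_distrib]
    | tmul φ a =>
      have h1 : ∀ w : H ⊗[k] H, dualTensorHomEquiv k H H (dualTensorAct φ w) h =
          TensorProduct.rid k H (φ.lTensor H ((1 ⊗ₜ h) * w)) := by
        intro w
        induction w with
        | zero => simp
        | add a b ha hb => simp only [map_add, LinearMap.add_apply, ha, hb, mul_add]
        | tmul p q => simp [dualTensorAct_tmul]
      have h2 : ∀ (b : H) (w : H ⊗[k] H), TensorProduct.rid k H (φ.lTensor H ((b ⊗ₜ 1) * w)) =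
          b * TensorProduct.rid k H (φ.lTensor H w) := by
        intro b w
        induction w with
        | zero => simp
        | add a b ha hb => simp only [map_add, ha, hb, mul_add]
        | tmul p q => simp
      change dualTensorHomEquiv k H H (dualTensorAct φ (comul a)) h = _
      rw [h1, hxy]
      simp only [map_sum, h2, dualTensorCoind_tmul]
  rw [key, hz]
  simp

/-- For a finite dimensional Hopf algebra, the coinduced module `H →ₗ[k] H` is isomorphic to the
underlying space of `H →ₗ[k] H` with `H` acting on values, compatibly with evaluation at `1`. -/
theorem exists_coind_retraction [Module.Finite k H] :
    ∃ τ : (H →ₗ[k] H) →ₗ[k] (H →ₗ[k] H), Function.Injective τ ∧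
      (∀ F h, τ (F ∘ₗ LinearMap.mulRight k h) = LinearMap.mulLeft k h ∘ₗ τ F) ∧
      ∀ a, τ (LinearMap.mulRight k a) 1 = a := by
  let Ψ := dualTensorCoind k H ∘ₗ (dualTensorHomEquiv k H H).symm.toLinearMap
  have hΨ : Function.Injective Ψ :=
    injective_dualTensorCoind.comp (dualTensorHomEquiv k H H).symm.injective
  let e := LinearEquiv.ofBijective Ψ ⟨hΨ, LinearMap.injective_iff_surjective.1 hΨ⟩
  have he : ∀ z, e (dualTensorHomEquiv k H H z) = dualTensorCoind k H z := fun z =>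
    congrArg (dualTensorCoind k H) (LinearEquiv.symm_apply_apply _ _)
  refine ⟨e.symm.toLinearMap, e.symm.injective, fun F h => ?_, fun a => ?_⟩
  · apply e.injective
    obtain ⟨G, rfl⟩ := e.surjective F
    obtain ⟨z, rfl⟩ := (dualTensorHomEquiv k H H).surjective G
    simp only [LinearEquiv.coe_coe, LinearEquiv.apply_symm_apply, LinearEquiv.symm_apply_apply]
    have h1 : LinearMap.mulLeft k h ∘ₗ dualTensorHomEquiv k H H z =
        dualTensorHomEquiv k H H ((LinearMap.mulLeft k h).lTensor _ z) := by
      induction z with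
      | zero => simp
      | add a b ha hb => simp only [map_add, LinearMap.comp_add, ha, hb]
      | tmul φ a => ext; simp
    rw [h1, he, he]
    clear h1
    induction z with
    | zero => simp
    | add a b ha hb => simp only [map_add, LinearMap.add_comp, ha, hb]
    | tmul φ a => ext; simp [dualTensorCoind_tmul, mul_assoc]
  · have h1 : e (dualTensorHomEquiv k H H (counit ⊗ₜ a)) = LinearMap.mulRight k a := by
      rw [he]
      ext y
      rw [dualTensorCoind_tmul, Coalgebra.lTensor_counit_comul]
      simp
    rw [← h1]
    simp

end

section

open Coalgebra HopfAlgebra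

variable {k : Type u} [Field k] {H : Type u} [Ring H] [HopfAlgebra k H]

/-- A finite dimensional Hopf algebra is self-injective. -/
theorem exists_extend_of_ker_le [Module.Finite k H] {A B : Type u} [AddCommGroup A] [Module k A]
    [Module H A] [IsScalarTower k H A] [AddCommGroup B] [Module k B] [Module H B]
    [IsScalarTower k H B] (d : A →ₗ[H] B) (f : A →ₗ[H] H)
    (h : LinearMap.ker d ≤ LinearMap.ker f) : ∃ g : B →ₗ[H] H, g ∘ₗ d = f := by
  obtain ⟨τ, -, hτ, hτ1⟩ := exists_coind_retraction (k := k) (H := H)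
  let d' := d.restrictScalars k
  have hd' : LinearMap.ker d' ≤ LinearMap.ker (f.restrictScalars k) := fun a ha => h ha
  obtain ⟨ψ, hψ⟩ := LinearMap.exists_extend
    ((LinearMap.ker d').liftQ (f.restrictScalars k) hd' ∘ₗ d'.quotKerEquivRange.symm.toLinearMap)
  have hψd : ∀ a, ψ (d a) = f a := by
    intro a
    have h1 := LinearMap.congr_fun hψ (d'.quotKerEquivRange (Submodule.Quotient.mk a))
    simp only [LinearMap.comp_apply, LinearEquiv.coe_coe, LinearEquiv.symm_apply_apply] at h1
    exact h1
  let act : B →ₗ[k] H →ₗ[k] H := LinearMap.mk₂ k (fun b y => ψ (y • b))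
    (fun b c y => by simp) (fun c b y => by rw [smul_algebra_smul_comm, map_smul])
    (fun b x y => by simp [add_smul]) (fun c b y => by simp)
  refine ⟨{ toFun := fun b => τ (act b) 1
            map_add' := fun b c => by simp
            map_smul' := fun h b => ?_ }, ?_⟩
  · have h1 : act (h • b) = act b ∘ₗ LinearMap.mulRight k h := by
      ext y
      simp [act, mul_smul]
    rw [h1, hτ]
    simp
  · ext a
    have h1 : act (d a) = LinearMap.mulRight k (f a) := by
      ext y
      simp only [act, LinearMap.mk₂_apply, ← map_smul, hψd, LinearMap.mulRight_apply]
      exact f.map_smul y a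
    simp only [LinearMap.comp_apply, LinearMap.coe_mk, AddHom.coe_mk, h1, hτ1]

theorem exists_extend_projective [Module.Finite k H] {A B Q : Type u} [AddCommGroup A] [Module k A]
    [Module H A] [IsScalarTower k H A] [AddCommGroup B] [Module k B] [Module H B]
    [IsScalarTower k H B] [AddCommGroup Q] [Module H Q] [Module.Finite H A] [Module.Projective H Q]
    (d : A →ₗ[H] B) (f : A →ₗ[H] Q)
    (h : LinearMap.ker d ≤ LinearMap.ker f) : ∃ g : B →ₗ[H] Q, g ∘ₗ d = f := by
  classical
  obtain ⟨s, hs⟩ := Module.projective_def'.1 ‹Module.Projective H Q›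
  have hext : ∀ q : Q, ∃ g : B →ₗ[H] H, g ∘ₗ d = Finsupp.lapply q ∘ₗ s ∘ₗ f := fun q =>
    exists_extend_of_ker_le (k := k) d _ fun a ha => by
      have : f a = 0 := h ha
      simp [this]
  choose g hg using hext
  obtain ⟨t, ht⟩ := (Module.Finite.fg_top : (⊤ : Submodule H A).FG)
  let S : Finset Q := t.biUnion fun a => (s (f a)).support
  have hS : ∀ a, s (f a) ∈ Finsupp.supported H H (S : Set Q) := by
    have : (⊤ : Submodule H A) ≤ (Finsupp.supported H H (S : Set Q)).comap (s ∘ₗ f) := by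
      rw [← ht, Submodule.span_le]
      intro a ha
      exact (Finsupp.mem_supported H _).2
        (Finset.coe_subset.2 (Finset.subset_biUnion_of_mem (fun a => (s (f a)).support) ha))
    exact fun a => this Submodule.mem_top
  refine ⟨∑ q ∈ S, LinearMap.toSpanSingleton H Q q ∘ₗ g q, ?_⟩
  ext a
  have h1 : ∀ q, g q (d a) = s (f a) q := fun q => LinearMap.congr_fun (hg q) a
  have h2 := LinearMap.congr_fun hs (f a)
  simp only [LinearMap.comp_apply, LinearMap.id_apply] at h2
  rw [Finsupp.linearCombination_apply, Finsupp.sum_of_support_subset _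
    (Finset.coe_subset.1 ((Finsupp.mem_supported H _).1 (hS a))) _ (by simp)] at h2
  simpa [h1] using h2

theorem exists_embedding_free [Module.Finite k H] {M : Type u} [AddCommGroup M] [Module k M]
    [Module H M] [IsScalarTower k H M] [Module.Finite k M] :
    ∃ (n : ℕ) (ι : M →ₗ[H] (Fin n → H)), Function.Injective ι := by
  obtain ⟨τ, hτi, hτ, -⟩ := exists_coind_retraction (k := k) (H := H)
  let b := Module.finBasis k M
  let c := Module.finBasis k H
  let act (i) : M →ₗ[k] H →ₗ[k] H := LinearMap.mk₂ k (fun m y => algebraMap k H (b.coord i (y • m)))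
    (fun m m' y => by simp) (fun a m y => by rw [smul_algebra_smul_comm]; simp [Algebra.smul_def])
    (fun m x y => by simp [add_smul])
    (fun a m y => by rw [smul_assoc, map_smul, smul_eq_mul, map_mul, Algebra.smul_def])
  have hact : ∀ i (h : H) m, act i (h • m) = act i m ∘ₗ LinearMap.mulRight k h := by
    intro i h m
    ext y
    simp [act, mul_smul]
  let ι : M →ₗ[H] (Fin (Module.finrank k M) × Fin (Module.finrank k H) → H) :=
    { toFun := fun m p => τ (act p.1 m) (c p.2)
      map_add' := fun m m' => by ext; simp
      map_smul' := fun h m => by ext; simp [hact, hτ] }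
  have hι : Function.Injective ι := by
    refine (injective_iff_map_eq_zero ι).2 fun m hm => b.ext_elem_iff.2 fun i => ?_
    have h1 : act i m = 0 := by
      apply hτi
      refine c.ext fun j => ?_
      rw [map_zero]
      exact congrFun hm (i, j)
    have h2 := LinearMap.congr_fun h1 1
    simp only [act, LinearMap.mk₂_apply, one_smul, LinearMap.zero_apply] at h2
    simpa using congrArg (counit (R := k)) h2
  exact ⟨_, (LinearEquiv.funCongrLeft H H finProdFinEquiv.symm).toLinearMap ∘ₗ ι,
    (LinearEquiv.injective (LinearEquiv.funCongrLeft H H finProdFinEquiv.symm)).comp hι⟩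

end

section complex

variable {R : Type u} [Ring R]

/-- The relation saying that `M'` is a syzygy of `M` with respect to a finite free module. -/
def IsFiniteSyzygy (M' M : ModuleCat.{u} R) : Prop :=
  ∃ (n : ℕ) (ι : M' →ₗ[R] (Fin n → R)) (π : (Fin n → R) →ₗ[R] M), Function.Injective ι ∧
    Function.Surjective π ∧ LinearMap.range ι = LinearMap.ker π

theorem exists_finiteSyzygy_sequence [IsNoetherianRing R]
    (hR : ∀ M : ModuleCat.{u} R, Module.Finite R M →
      ∃ (n : ℕ) (ι : M →ₗ[R] (Fin n → R)), Function.Injective ι)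
    (M : ModuleCat.{u} R) [Module.Finite R M] :
    ∃ Z : ℤ → ModuleCat.{u} R, Z 0 = M ∧ ∀ i, IsFiniteSyzygy (Z (i + 1)) (Z i) := by
  have hsyz : ∀ M : {M : ModuleCat.{u} R // Module.Finite R M},
      ∃ M' : {M : ModuleCat.{u} R // Module.Finite R M}, IsFiniteSyzygy M'.1 M.1 := by
    rintro ⟨M, hM⟩
    obtain ⟨n, π, hπ⟩ := Module.Finite.exists_fin' R M
    exact ⟨⟨ModuleCat.of R (LinearMap.ker π), inferInstanceAs (Module.Finite R (LinearMap.ker π))⟩,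
      n, (LinearMap.ker π).subtype, π, Submodule.injective_subtype _, hπ, by simp⟩
  have hcosyz : ∀ M : {M : ModuleCat.{u} R // Module.Finite R M},
      ∃ M' : {M : ModuleCat.{u} R // Module.Finite R M}, IsFiniteSyzygy M.1 M'.1 := by
    rintro ⟨M, hM⟩
    obtain ⟨n, ι, hι⟩ := hR M hM
    exact ⟨⟨ModuleCat.of R ((Fin n → R) ⧸ LinearMap.range ι),
      inferInstanceAs (Module.Finite R ((Fin n → R) ⧸ LinearMap.range ι))⟩,
      n, ι, (LinearMap.range ι).mkQ, hι, Submodule.mkQ_surjective _, by simp⟩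
  choose f hf using hsyz
  choose g hg using hcosyz
  let M₀ : {M : ModuleCat.{u} R // Module.Finite R M} := ⟨M, inferInstance⟩
  let Z : ℤ → {M : ModuleCat.{u} R // Module.Finite R M}
    | .ofNat n => f^[n] M₀
    | .negSucc n => g^[n + 1] M₀
  refine ⟨fun i => (Z i).1, rfl, fun i => ?_⟩
  obtain n | n := i
  · change IsFiniteSyzygy (f^[n + 1] M₀).1 (f^[n] M₀).1
    rw [Function.iterate_succ_apply']
    exact hf _
  · obtain _ | n := n
    · exact hg M₀
    · change IsFiniteSyzygy (g^[n + 1] M₀).1 (g^[n + 1 + 1] M₀).1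
      rw [Function.iterate_succ_apply' g (n + 1)]
      exact hg _

theorem isGorensteinProjective_of_extend [IsNoetherianRing R]
    (hR : ∀ M : ModuleCat.{u} R, Module.Finite R M →
      ∃ (n : ℕ) (ι : M →ₗ[R] (Fin n → R)), Function.Injective ι)
    (hR' : ∀ (Q : ModuleCat.{u} R), Module.Projective R Q → ∀ (m n : ℕ)
      (d : (Fin m → R) →ₗ[R] (Fin n → R)) (f : (Fin m → R) →ₗ[R] Q),
      LinearMap.ker d ≤ LinearMap.ker f → ∃ g : (Fin n → R) →ₗ[R] Q, g ∘ₗ d = f)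
    (M : ModuleCat.{u} R) [Module.Finite R M] : IsGorensteinProjective R M := by
  obtain ⟨Z, hZ0, hZ⟩ := exists_finiteSyzygy_sequence hR M
  have hZ' : ∀ i, IsFiniteSyzygy (Z (i + 1 - 2)) (Z (i - 2)) := fun i => by
    rw [show i + 1 - 2 = i - 2 + 1 by ring]
    exact hZ _
  choose n ι π hι hπ hιπ using hZ'
  have hrange : ∀ i, LinearMap.range (ι (i + 1) ∘ₗ π (i + 1 + 1)) = LinearMap.range (ι (i + 1)) :=
    fun i => LinearMap.range_comp_of_range_eq_top _ (LinearMap.range_eq_top.2 (hπ _))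
  have hker : ∀ i, LinearMap.ker (ι i ∘ₗ π (i + 1)) = LinearMap.ker (π (i + 1)) :=
    fun i => LinearMap.ker_comp_of_ker_eq_bot _ (LinearMap.ker_eq_bot.2 (hι _))
  have hexact : ∀ i, LinearMap.range (ι (i + 1) ∘ₗ π (i + 1 + 1)) =
      LinearMap.ker (ι i ∘ₗ π (i + 1)) := fun i => by rw [hrange, hker, hιπ]
  refine ⟨fun i => ModuleCat.of R (Fin (n i) → R), fun i => ι i ∘ₗ π (i + 1),
    fun i => inferInstanceAs (Module.Projective R (Fin (n i) → R)), hexact,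
    fun Q hQ i f hf => hR' Q hQ _ _ _ f ?_, ?_⟩
  · rw [← hexact]
    exact LinearMap.range_le_ker_iff.2 hf
  · have h2 : Z (0 + 1 + 1 - 2) = M := hZ0
    have e : LinearMap.ker (ι 0 ∘ₗ π (0 + 1)) = LinearMap.range (ι (0 + 1)) := by
      rw [hker, hιπ]
    rw [← h2]
    exact ⟨(LinearEquiv.ofInjective (ι (0 + 1)) (hι _)).trans (LinearEquiv.ofEq _ _ e.symm)⟩

end complex

section

open Coalgebra HopfAlgebra

variable {k : Type u} [Field k] {H : Type u} [Ring H] [HopfAlgebra k H]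

theorem isGorensteinProjective_of_finite [Module.Finite k H] (M : ModuleCat.{u} H)
    [Module.Finite H M] : IsGorensteinProjective H M := by
  have : IsNoetherianRing H := isNoetherian_of_tower k inferInstance
  refine isGorensteinProjective_of_extend (fun M hM => ?_) (fun Q hQ m n d f h => ?_) M
  · let _ : Module k M := Module.compHom M (algebraMap k H)
    have : IsScalarTower k H M := ⟨fun c h m => by
      rw [Algebra.smul_def, mul_smul]
      rfl⟩
    have : Module.Finite k M := Module.Finite.trans H M
    exact exists_embedding_free (k := k)
  · exact exists_extend_projective (k := k) d f h

variable (k H) in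
theorem finite_trivMod : Module.Finite H (trivMod k H) := by
  let e : trivMod k H := (1 : k)
  refine Module.Finite.of_surjective (LinearMap.toSpanSingleton H (trivMod k H) e)
    fun (c : k) => ⟨algebraMap k H c, ?_⟩
  exact (mul_one (counit (R := k) (algebraMap k H c))).trans (Bialgebra.counit_algebraMap c)

theorem finite_iff_exists_embedding (hS : Function.Bijective (antipode k (A := H))) :
    Module.Finite k H ↔ ∃ (P : ModuleCat.{u} H) (ι : trivMod k H →ₗ[H] P),
      Module.Projective H P ∧ Function.Injective ι := by
  constructor
  · intro _
    have := finite_trivMod k H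
    exact (isGorensteinProjective_of_finite (k := k) _).exists_embedding
  · rintro ⟨P, ι, hP, hι⟩
    exact finite_of_trivMod_embeds hS ι hι

theorem finite_iff_gProjDim_trivMod (hS : Function.Bijective (antipode k (A := H))) :
    Module.Finite k H ↔ gProjDim H (trivMod k H) = 0 := by
  rw [gProjDim_eq_zero_iff]
  constructor
  · intro _
    have := finite_trivMod k H
    exact isGorensteinProjective_of_finite (k := k) _
  · exact fun h => (finite_iff_exists_embedding hS).2 h.exists_embedding

end

/-- Let `H` be a Hopf algebra over a field `k` with bijective antipode.
The following are equivalent: (1) `H` is finite dimensional over `k`; (2) `H` is left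
(equivalently right) artinian; (3) the trivial left (or right) `H`-module is Gorenstein
projective, i.e. `Gpd_H(εk) = 0` (or `Gpd_{Hᵒᵖ}(k_ε) = 0`); (4) as a left (or right)
`H`-module, `k` embeds into a projective module. -/
theorem finiteDimensional_iff_trivial_gorenstein (k : Type u) [Field k]
    (H : Type u) [Ring H] [HopfAlgebra k H]
    (hS : Function.Bijective (HopfAlgebra.antipode (R := k) (A := H))) :
    (Module.Finite k H ↔ IsArtinian H H) ∧
    (Module.Finite k H ↔ IsArtinian Hᵐᵒᵖ Hᵐᵒᵖ) ∧
    (Module.Finite k H ↔ gProjDim H (trivMod k H) = 0) ∧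
    (Module.Finite k H ↔ gProjDim Hᵐᵒᵖ (trivModOp k H) = 0) ∧
    (Module.Finite k H ↔
      ∃ (P : ModuleCat.{u} H) (ι : trivMod k H →ₗ[H] P),
        Module.Projective H P ∧ Function.Injective ι) ∧
    (Module.Finite k H ↔
      ∃ (P : ModuleCat.{u} Hᵐᵒᵖ) (ι : trivModOp k H →ₗ[Hᵐᵒᵖ] P),
        Module.Projective Hᵐᵒᵖ P ∧ Function.Injective ι) := by
  have hfin : Module.Finite k H ↔ Module.Finite k Hᵐᵒᵖ :=
    Module.Finite.equiv_iff (MulOpposite.opLinearEquiv k)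
  have hop := bijective_antipode_opHopfAlgebra hS
  refine ⟨finite_iff_isArtinian hS, hfin.trans ?_, finite_iff_gProjDim_trivMod hS, hfin.trans ?_,
    finite_iff_exists_embedding hS, hfin.trans ?_⟩
  · exact @finite_iff_isArtinian k _ Hᵐᵒᵖ _ (opHopfAlgebra hS) hop
  · exact @finite_iff_gProjDim_trivMod k _ Hᵐᵒᵖ _ (opHopfAlgebra hS) hop
  · exact @finite_iff_exists_embedding k _ Hᵐᵒᵖ _ (opHopfAlgebra hS) hop
end

section
/- Let H be a Hopf algebra over a field k and let H^e = H ⊗_k H^op be its enveloping algebra. For any left H-module M, endow M ⊗_k H with the H-bimodule (i.e. left H^e-module) structure h'(m ⊗ h)h'' = Σ h'₁·m ⊗ h'₂ h h''. Then Gpd_H(M) = Gpd_{H^e}(M ⊗_k H). -/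
open TensorProduct

universe u

/-- The scalar multiplication of an explicitly given module structure. -/
def modSMul {R M : Type u} [Semiring R] [AddCommMonoid M] (i : Module R M) (r : R) (m : M) : M :=
  letI := i; r • m

namespace GorensteinProjective

section Modules

variable {R : Type u} [Ring R]

/-- `0 → A → B → C → 0` is a short exact sequence of modules. -/
structure IsShortExact {A B C : Type u} [AddCommGroup A] [Module R A] [AddCommGroup B] [Module R B]
    [AddCommGroup C] [Module R C] (f : A →ₗ[R] B) (g : B →ₗ[R] C) : Prop where
  inj : Function.Injective f
  exact : Function.Exact f g
  surj : Function.Surjective g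

/-- Every linear map from the source of `f` to a projective module extends along `f`. -/
def ExtendsToProjective {A B : Type u} [AddCommGroup A] [Module R A] [AddCommGroup B] [Module R B]
    (f : A →ₗ[R] B) : Prop :=
  ∀ (Q : ModuleCat.{u} R), Module.Projective R Q → ∀ φ : A →ₗ[R] Q, ∃ ψ : B →ₗ[R] Q, ψ ∘ₗ f = φ

variable (R) in
/-- The vanishing of `Ext¹(C, Q)` for all projective modules `Q`. -/
def IsExtPerp (C : Type u) [AddCommGroup C] [Module R C] : Prop :=
  ∀ (A B : ModuleCat.{u} R) (f : A →ₗ[R] B) (g : B →ₗ[R] C), IsShortExact f g →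
    ExtendsToProjective f

variable {A B C P M N : Type u} [AddCommGroup A] [Module R A] [AddCommGroup B] [Module R B]
  [AddCommGroup C] [Module R C] [AddCommGroup P] [Module R P] [AddCommGroup M] [Module R M]
  [AddCommGroup N] [Module R N]

theorem IsExtPerp.extends (hC : IsExtPerp R C) {f : A →ₗ[R] B} {g : B →ₗ[R] C}
    (h : IsShortExact f g) : ExtendsToProjective f :=
  hC (.of R A) (.of R B) f g h

theorem IsExtPerp.exists_extension (hC : IsExtPerp R C) {f : A →ₗ[R] B} {g : B →ₗ[R] C}
    (h : IsShortExact f g) [hP : Module.Projective R P] (φ : A →ₗ[R] P) :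
    ∃ ψ : B →ₗ[R] P, ψ ∘ₗ f = φ :=
  hC.extends h (.of R P) hP φ

theorem isShortExact_ker {g : B →ₗ[R] C} (hg : Function.Surjective g) :
    IsShortExact (LinearMap.ker g).subtype g :=
  ⟨Subtype.val_injective, fun x => by simp, hg⟩

theorem isShortExact_mkQ {f : A →ₗ[R] B} (hf : Function.Injective f) :
    IsShortExact f (LinearMap.range f).mkQ :=
  ⟨hf, fun x => by simp, Submodule.mkQ_surjective _⟩

theorem IsShortExact.exists_preimage {f : A →ₗ[R] B} {g : B →ₗ[R] C} (h : IsShortExact f g)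
    {b : B} (hb : g b = 0) : ∃ a, f a = b :=
  (h.exact b).1 hb

theorem IsShortExact.comp_apply {f : A →ₗ[R] B} {g : B →ₗ[R] C} (h : IsShortExact f g) (a : A) :
    g (f a) = 0 :=
  (h.exact (f a)).2 ⟨a, rfl⟩

theorem IsShortExact.lift {f : A →ₗ[R] B} {g : B →ₗ[R] C} (h : IsShortExact f g)
    (θ : M →ₗ[R] B) (hθ : ∀ m, g (θ m) = 0) : ∃ η : M →ₗ[R] A, ∀ m, f (η m) = θ m := by
  let e := LinearEquiv.ofInjective f h.inj
  have hr : ∀ m, θ m ∈ LinearMap.range f := fun m => h.exists_preimage (hθ m)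
  refine ⟨e.symm.toLinearMap ∘ₗ θ.codRestrict _ hr, fun m => ?_⟩
  have := e.apply_symm_apply (θ.codRestrict _ hr m)
  exact congrArg Subtype.val this

theorem exists_factorization {g : B →ₗ[R] C} (hg : Function.Surjective g)
    (θ : B →ₗ[R] M) (hθ : ∀ b, g b = 0 → θ b = 0) : ∃ η : C →ₗ[R] M, ∀ b, η (g b) = θ b := by
  have hle : LinearMap.ker g ≤ LinearMap.ker θ := fun b hb => hθ b hb
  refine ⟨(LinearMap.ker g).liftQ θ hle ∘ₗ (g.quotKerEquivOfSurjective hg).symm.toLinearMap,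
    fun b => ?_⟩
  have : (g.quotKerEquivOfSurjective hg).symm (g b) = (LinearMap.ker g).mkQ b := by
    rw [LinearEquiv.symm_apply_eq]; rfl
  simp [this]

theorem exists_lift (hP : Module.Projective R P) {g : B →ₗ[R] C} (hg : Function.Surjective g)
    (θ : P →ₗ[R] C) : ∃ s : P →ₗ[R] B, ∀ p, g (s p) = θ p := by
  obtain ⟨s, hs⟩ := Module.projective_lifting_property g θ hg
  exact ⟨s, fun p => LinearMap.congr_fun hs p⟩

variable (R M) in
theorem exists_projective_cover : ∃ (P : ModuleCat.{u} R) (g : P →ₗ[R] M),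
    Module.Projective R P ∧ Function.Surjective g :=
  ⟨.of R (M →₀ R), Finsupp.linearCombination R id, inferInstanceAs (Module.Projective R (M →₀ R)),
    Finsupp.linearCombination_id_surjective R M⟩

theorem isExtPerp_of_extends {f : A →ₗ[R] P} {g : P →ₗ[R] C} (h : IsShortExact f g)
    (hP : Module.Projective R P) (hf : ExtendsToProjective f) : IsExtPerp R C := by
  intro A' B' f' g' h' Q hQ φ
  obtain ⟨s, hs⟩ := exists_lift hP h'.surj g
  obtain ⟨t, ht⟩ := h'.lift (s ∘ₗ f) (fun a => by simp [hs, h.comp_apply])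
  obtain ⟨χ, hχ⟩ := hf Q hQ (φ ∘ₗ t)
  have hχ' : ∀ a, χ (f a) = φ (t a) := fun a => LinearMap.congr_fun hχ a
  have hsurj : Function.Surjective (s.coprod f') := by
    intro b
    obtain ⟨p, hp⟩ := h.surj (g' b)
    obtain ⟨a, ha⟩ := h'.exists_preimage (b := b - s p) (by simp [hs, hp])
    exact ⟨(p, a), by simp [ha]⟩
  obtain ⟨ψ, hψ⟩ := exists_factorization hsurj (χ.coprod φ) (by
    rintro ⟨p, a⟩ hpa
    simp only [LinearMap.coprod_apply] at hpa ⊢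
    obtain ⟨c, rfl⟩ := h.exists_preimage (b := p) (by
      have := congrArg g' hpa
      simpa [hs, h'.comp_apply] using this)
    have : t c + a = 0 := h'.inj (by rw [map_add, ht]; simpa using hpa)
    rw [hχ', ← map_add, this, map_zero])
  refine ⟨ψ, LinearMap.ext fun a => ?_⟩
  simpa using hψ (0, a)

theorem isExtPerp_of_projective (hP : Module.Projective R P) : IsExtPerp R P := by
  intro A B f g h Q _ φ
  obtain ⟨s, hs⟩ := exists_lift hP h.surj LinearMap.id
  obtain ⟨r, hr⟩ := h.lift (LinearMap.id - s ∘ₗ g) (fun m => by simp [hs])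
  refine ⟨φ ∘ₗ r, LinearMap.ext fun a => ?_⟩
  have : r (f a) = a := h.inj (by simp [hr, h.comp_apply])
  simp [this]

theorem IsExtPerp.of_extension {f : A →ₗ[R] B} {g : B →ₗ[R] C} (h : IsShortExact f g)
    (hA : IsExtPerp R A) (hC : IsExtPerp R C) : IsExtPerp R B := by
  intro L E i p hE Q hQ φ
  let K := LinearMap.ker (g ∘ₗ p)
  obtain ⟨q, hq⟩ := h.lift (p ∘ₗ K.subtype) (fun m => m.2)
  obtain ⟨j, hj⟩ := (isShortExact_ker (g := g ∘ₗ p) (h.surj.comp hE.surj)).lift i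
    (fun m => by simp [hE.comp_apply])
  have h1 : IsShortExact j q := by
    refine ⟨fun x y hxy => hE.inj ?_, fun x => ⟨fun hx => ?_, ?_⟩, fun a => ?_⟩
    · rw [← hj, ← hj, hxy]
    · have : p x = 0 := by have := hq x; rw [hx, map_zero] at this; exact this.symm
      obtain ⟨l, hl⟩ := hE.exists_preimage this
      exact ⟨l, Subtype.ext (by rw [← hl]; exact hj l)⟩
    · rintro ⟨l, rfl⟩
      apply h.inj
      rw [hq, map_zero]
      have := hj l
      simp only [Submodule.subtype_apply] at this
      simp [this, hE.comp_apply]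
    · obtain ⟨e, he⟩ := hE.surj (f a)
      refine ⟨⟨e, by simp [he, h.comp_apply]⟩, h.inj ?_⟩
      rw [hq]; simpa using he
  obtain ⟨χ, hχ⟩ := hA.exists_extension (P := Q) h1 φ
  obtain ⟨ψ, hψ⟩ := hC.exists_extension (P := Q)
    (isShortExact_ker (g := g ∘ₗ p) (h.surj.comp hE.surj)) χ
  refine ⟨ψ, LinearMap.ext fun l => ?_⟩
  rw [← hχ, ← hψ]
  simp only [LinearMap.comp_apply]
  rw [hj]

theorem IsExtPerp.of_retract {i : A →ₗ[R] B} {r : B →ₗ[R] A} (hr : ∀ a, r (i a) = a)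
    (hB : IsExtPerp R B) : IsExtPerp R A := by
  obtain ⟨P, g, hP, hg⟩ := exists_projective_cover R A
  obtain ⟨P', g', hP', hg'⟩ := exists_projective_cover R B
  refine isExtPerp_of_extends (isShortExact_ker hg) hP fun Q hQ φ => ?_
  obtain ⟨s, hs⟩ := exists_lift hP hg' (i ∘ₗ g)
  obtain ⟨t, ht⟩ := exists_lift hP' hg (r ∘ₗ g')
  obtain ⟨t', ht'⟩ := (isShortExact_ker hg).lift (t ∘ₗ (LinearMap.ker g').subtype)
    (fun m => by simp [ht])
  obtain ⟨ψ, hψ⟩ := hB.exists_extension (P := Q) (isShortExact_ker hg') (φ ∘ₗ t')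
  obtain ⟨d, hd⟩ := (isShortExact_ker hg).lift (LinearMap.id - t ∘ₗ s)
    (fun m => by simp [ht, hs, hr])
  refine ⟨ψ ∘ₗ s + φ ∘ₗ d, LinearMap.ext fun k => ?_⟩
  have hsk : g' (s k) = 0 := by rw [hs]; simp
  have h1 : ψ (s k) = φ (t' ⟨s k, hsk⟩) := LinearMap.congr_fun hψ ⟨s k, hsk⟩
  have h2 : t' ⟨s k, hsk⟩ + d k = k := Subtype.ext (by
    have e1 := ht' ⟨s k, hsk⟩
    have e2 := hd k
    simp only [Submodule.subtype_apply] at e1 e2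
    simp [e1, e2])
  simp [h1, ← map_add, h2]

variable (R) in
/-- A class of modules all of which are syzygies of totally acyclic complexes whose syzygies lie
in the class. -/
structure IsGorensteinClass (X : ModuleCat.{u} R → Prop) : Prop where
  perp : ∀ M, X M → IsExtPerp R M
  coresolve : ∀ M, X M → ∃ (P N : ModuleCat.{u} R) (f : M →ₗ[R] P) (g : P →ₗ[R] N),
    Module.Projective R P ∧ IsShortExact f g ∧ X N
  resolve : ∀ M, X M → ∃ (K P : ModuleCat.{u} R) (f : K →ₗ[R] P) (g : P →ₗ[R] M),
    Module.Projective R P ∧ IsShortExact f g ∧ X K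

theorem exists_int_sequence {α : Type*} {r : α → α → Prop} (hu : ∀ a, ∃ b, r b a)
    (hd : ∀ a, ∃ b, r a b) (a : α) : ∃ w : ℤ → α, w 0 = a ∧ ∀ i, r (w (i + 1)) (w i) := by
  choose u hu using hu
  choose v hv using hd
  let w : ℤ → α
    | .ofNat n => u^[n] a
    | .negSucc n => v^[n + 1] a
  refine ⟨w, rfl, fun i => ?_⟩
  match i with
  | .ofNat n =>
    change r (u^[n + 1] a) (u^[n] a)
    rw [Function.iterate_succ_apply']
    exact hu _
  | .negSucc 0 => exact hv _
  | .negSucc (n + 1) =>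
    change r (v^[n + 1] a) (v^[n + 1 + 1] a)
    rw [Function.iterate_succ_apply' v (n + 1)]
    exact hv _

theorem IsGorensteinClass.isGorensteinProjective {X : ModuleCat.{u} R → Prop}
    (hX : IsGorensteinClass R X) {M : ModuleCat.{u} R} (hM : X M) :
    IsGorensteinProjective R M := by
  let r : {M // X M} → {M // X M} → Prop := fun K M => ∃ (P : ModuleCat.{u} R)
    (f : K.1 →ₗ[R] P) (g : P →ₗ[R] M.1), Module.Projective R P ∧ IsShortExact f g
  obtain ⟨w', hw0, hw'⟩ := exists_int_sequence (r := r)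
    (fun M => by
      obtain ⟨K, P, f, g, hP, h, hK⟩ := hX.resolve M.1 M.2
      exact ⟨⟨K, hK⟩, P, f, g, hP, h⟩)
    (fun M => by
      obtain ⟨P, N, f, g, hP, h, hN⟩ := hX.coresolve M.1 M.2
      exact ⟨⟨N, hN⟩, P, f, g, hP, h⟩) ⟨M, hM⟩
  obtain ⟨w, hw2, hw⟩ : ∃ w : ℤ → {M // X M}, w (0 + 1 + 1) = ⟨M, hM⟩ ∧
      ∀ i, r (w (i + 1)) (w i) := by
    refine ⟨fun i => w' (i - 2), by simpa using hw0, fun i => ?_⟩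
    have : i + 1 - 2 = i - 2 + 1 := by ring
    simpa only [this] using hw' (i - 2)
  choose P f g hP h using hw
  refine ⟨P, fun i => f i ∘ₗ g (i + 1), hP, fun i => ?_, fun Q hQ i φ hφ => ?_, ?_⟩
  · ext x
    simp only [LinearMap.mem_range, LinearMap.comp_apply, LinearMap.mem_ker]
    constructor
    · rintro ⟨y, rfl⟩
      rw [(h (i + 1)).comp_apply, map_zero]
    · intro hx
      have : g (i + 1) x = 0 := (h i).inj (by rw [hx, map_zero])
      obtain ⟨z, rfl⟩ := (h (i + 1)).exists_preimage this
      obtain ⟨y, rfl⟩ := (h (i + 1 + 1)).surj z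
      exact ⟨y, rfl⟩
  · obtain ⟨η, hη⟩ := exists_factorization (h (i + 1)).surj φ (fun b hb => by
      obtain ⟨z, rfl⟩ := (h (i + 1)).exists_preimage hb
      obtain ⟨y, rfl⟩ := (h (i + 1 + 1)).surj z
      exact LinearMap.congr_fun hφ y)
    obtain ⟨ψ, hψ⟩ := (hX.perp _ (w i).2).exists_extension (P := Q) (h i) η
    refine ⟨ψ, LinearMap.ext fun x => ?_⟩
    rw [← hη, ← hψ]
    rfl
  · have hk : LinearMap.ker (f 0 ∘ₗ g (0 + 1)) = LinearMap.range (f (0 + 1)) := by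
      ext x
      rw [LinearMap.ker_comp_of_ker_eq_bot _ (LinearMap.ker_eq_bot.2 (h 0).inj)]
      exact (h (0 + 1)).exact x
    have e : (w (0 + 1 + 1)).1 ≃ₗ[R] LinearMap.ker (f 0 ∘ₗ g (0 + 1)) :=
      (LinearEquiv.ofInjective _ (h (0 + 1)).inj).trans (LinearEquiv.ofEq _ _ hk.symm)
    rw [hw2] at e
    exact ⟨e⟩

theorem IsShortExact.of_equiv_left {f : A →ₗ[R] B} {g : B →ₗ[R] C} (h : IsShortExact f g)
    (e : M ≃ₗ[R] A) : IsShortExact (f ∘ₗ e.toLinearMap) g :=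
  ⟨h.inj.comp e.injective, fun b => by
    rw [h.exact b]
    exact ⟨fun ⟨a, ha⟩ => ⟨e.symm a, by simp [ha]⟩, fun ⟨a, ha⟩ => ⟨e a, ha⟩⟩, h.surj⟩

theorem IsShortExact.of_equiv_right {f : A →ₗ[R] B} {g : B →ₗ[R] C} (h : IsShortExact f g)
    (e : C ≃ₗ[R] M) : IsShortExact f (e.toLinearMap ∘ₗ g) :=
  ⟨h.inj, fun b => by simpa using h.exact b, e.surjective.comp h.surj⟩

theorem isGorensteinProjective_of_equiv (e : M ≃ₗ[R] N) (hN : IsGorensteinProjective R N) :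
    IsGorensteinProjective R M := by
  obtain ⟨P, d, hP, hd, hQ, ⟨e'⟩⟩ := hN
  exact ⟨P, d, hP, hd, hQ, ⟨e.trans e'⟩⟩

variable (R) in
theorem isGorensteinClass_isGorensteinProjective :
    IsGorensteinClass R (fun M => IsGorensteinProjective R M) := by
  let X : ModuleCat.{u} R → Prop := fun M =>
    ∃ (P : ℤ → ModuleCat.{u} R) (d : ∀ i : ℤ, P (i + 1) →ₗ[R] P i) (j : ℤ),
    (∀ i, Module.Projective R (P i)) ∧
    (∀ i, LinearMap.range (d (i + 1)) = LinearMap.ker (d i)) ∧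
    (∀ (Q : ModuleCat.{u} R), Module.Projective R Q →
      ∀ (i : ℤ) (f : P (i + 1) →ₗ[R] Q), f.comp (d (i + 1)) = 0 →
        ∃ g : P i →ₗ[R] Q, g.comp (d i) = f) ∧
    Nonempty (M ≃ₗ[R] LinearMap.ker (d j))
  have key : ∀ (P : ℤ → ModuleCat.{u} R) (d : ∀ i : ℤ, P (i + 1) →ₗ[R] P i) (i : ℤ),
      LinearMap.range (d (i + 1)) = LinearMap.ker (d i) →
      ∃ g : P (i + 1 + 1) →ₗ[R] LinearMap.ker (d i),
        (∀ x, (g x : P (i + 1)) = d (i + 1) x) ∧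
        IsShortExact (LinearMap.ker (d (i + 1))).subtype g := by
    intro P d i hd
    have hr : ∀ x, d (i + 1) x ∈ LinearMap.ker (d i) := fun x =>
      hd.le (LinearMap.mem_range_self _ x)
    refine ⟨(d (i + 1)).codRestrict _ hr, fun _ => rfl, Subtype.val_injective, fun x => ?_,
      fun y => ?_⟩
    · simp [Subtype.ext_iff]
    · obtain ⟨x, hx⟩ : (y : P (i + 1)) ∈ LinearMap.range (d (i + 1)) := hd.ge y.2
      exact ⟨x, Subtype.ext hx⟩
  have hX : IsGorensteinClass R X := by
    refine ⟨fun M hM => ?_, fun M hM => ?_, fun M hM => ?_⟩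
    · obtain ⟨P, d, j, hP, hd, hQ, ⟨e⟩⟩ := hM
      obtain ⟨g, hg, h⟩ := key P d j (hd j)
      refine isExtPerp_of_extends (h.of_equiv_right e.symm) (hP _) fun Q hQ' φ => ?_
      obtain ⟨g', hg', h'⟩ := key P d (j + 1) (hd (j + 1))
      obtain ⟨ψ, hψ⟩ := hQ Q hQ' (j + 1 + 1) (φ ∘ₗ g') (LinearMap.ext fun x => by
        have : g' (d (j + 1 + 1 + 1) x) = 0 := Subtype.ext (by
          rw [hg']
          have : d (j + 1 + 1 + 1) x ∈ LinearMap.ker (d (j + 1 + 1)) :=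
            (hd (j + 1 + 1)).le (LinearMap.mem_range_self _ x)
          exact this)
        simp [this])
      refine ⟨ψ, LinearMap.ext fun y => ?_⟩
      obtain ⟨x, rfl⟩ := h'.surj y
      have := LinearMap.congr_fun hψ x
      simp only [LinearMap.comp_apply] at this
      rw [← this, ← hg']
      rfl
    · obtain ⟨P, d, j, hP, hd, hQ, ⟨e⟩⟩ := hM
      obtain ⟨j, rfl⟩ : ∃ i, j = i + 1 := ⟨j - 1, by ring⟩
      obtain ⟨g, -, h⟩ := key P d j (hd j)
      exact ⟨P (j + 1 + 1), .of R (LinearMap.ker (d j)), _, g, hP _, h.of_equiv_left e,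
        P, d, j, hP, hd, hQ, ⟨LinearEquiv.refl _ _⟩⟩
    · obtain ⟨P, d, j, hP, hd, hQ, ⟨e⟩⟩ := hM
      obtain ⟨g, -, h⟩ := key P d j (hd j)
      exact ⟨.of R (LinearMap.ker (d (j + 1))), P (j + 1 + 1), _, _, hP _,
        h.of_equiv_right e.symm, P, d, j + 1, hP, hd, hQ, ⟨LinearEquiv.refl _ _⟩⟩
  have hGX : ∀ M : ModuleCat.{u} R, IsGorensteinProjective R M → X M := by
    rintro M ⟨P, d, h⟩
    exact ⟨P, d, 0, h⟩
  refine ⟨fun M hM => hX.perp M (hGX M hM), fun M hM => ?_, fun M hM => ?_⟩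
  · obtain ⟨P, N, f, g, hP, h, hN⟩ := hX.coresolve M (hGX M hM)
    exact ⟨P, N, f, g, hP, h, hX.isGorensteinProjective hN⟩
  · obtain ⟨K, P, f, g, hP, h, hK⟩ := hX.resolve M (hGX M hM)
    exact ⟨K, P, f, g, hP, h, hX.isGorensteinProjective hK⟩

theorem isExtPerp_of_isGorensteinProjective (hM : IsGorensteinProjective R M) : IsExtPerp R M :=
  (isGorensteinClass_isGorensteinProjective R).perp (.of R M) hM

theorem exists_coresolution (hM : IsGorensteinProjective R M) :
    ∃ (P N : ModuleCat.{u} R) (f : M →ₗ[R] P) (g : P →ₗ[R] N),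
      Module.Projective R P ∧ IsShortExact f g ∧ IsGorensteinProjective R N :=
  (isGorensteinClass_isGorensteinProjective R).coresolve (.of R M) hM

theorem exists_resolution (hM : IsGorensteinProjective R M) :
    ∃ (K P : ModuleCat.{u} R) (f : K →ₗ[R] P) (g : P →ₗ[R] M),
      Module.Projective R P ∧ IsShortExact f g ∧ IsGorensteinProjective R K :=
  (isGorensteinClass_isGorensteinProjective R).resolve (.of R M) hM

theorem isGorensteinProjective_of_projective (hM : Module.Projective R M) :
    IsGorensteinProjective R M := by
  have hX : IsGorensteinClass R (fun M => Module.Projective R M) := by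
    refine ⟨fun M hM => isExtPerp_of_projective hM, fun M hM => ?_, fun M hM => ?_⟩
    · exact ⟨M, .of R PUnit, LinearMap.id, 0, hM,
        ⟨fun _ _ h => h, fun x => by simp, fun x => ⟨0, Subsingleton.elim _ _⟩⟩,
        inferInstanceAs (Module.Projective R PUnit.{u + 1})⟩
    · exact ⟨.of R PUnit, M, 0, LinearMap.id, hM,
        ⟨fun _ _ _ => Subsingleton.elim _ _, fun x => by simp [eq_comm], fun x => ⟨x, rfl⟩⟩,
        inferInstanceAs (Module.Projective R PUnit.{u + 1})⟩
  exact hX.isGorensteinProjective (M := .of R M) hM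

theorem isGorensteinProjective_of_extension {f : A →ₗ[R] B} {g : B →ₗ[R] C}
    (h : IsShortExact f g) (hA : IsGorensteinProjective R A) (hC : IsGorensteinProjective R C) :
    IsGorensteinProjective R B := by
  have hX : IsGorensteinClass R (fun B => ∃ (A C : ModuleCat.{u} R) (f : A →ₗ[R] B)
      (g : B →ₗ[R] C), IsShortExact f g ∧ IsGorensteinProjective R A ∧
        IsGorensteinProjective R C) := by
    refine ⟨?_, ?_, ?_⟩
    · rintro B ⟨A, C, f, g, h, hA, hC⟩
      exact .of_extension h (isExtPerp_of_isGorensteinProjective hA)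
        (isExtPerp_of_isGorensteinProjective hC)
    · rintro B ⟨A, C, f, g, h, hA, hC⟩
      obtain ⟨P₁, A', i₁, p₁, hP₁, h₁, hA'⟩ := exists_coresolution hA
      obtain ⟨P₂, C', i₂, p₂, hP₂, h₂, hC'⟩ := exists_coresolution hC
      obtain ⟨θ, hθ⟩ := (isExtPerp_of_isGorensteinProjective hC).exists_extension h i₁
      replace hθ : ∀ a, θ (f a) = i₁ a := fun a => LinearMap.congr_fun hθ a
      let j : B →ₗ[R] P₁ × P₂ := θ.prod (i₂ ∘ₗ g)
      have hj : Function.Injective j := by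
        rw [injective_iff_map_eq_zero]
        intro b hb
        have hb1 : θ b = 0 := congrArg Prod.fst hb
        have hb2 : i₂ (g b) = 0 := congrArg Prod.snd hb
        obtain ⟨a, rfl⟩ := h.exists_preimage (h₂.inj (hb2.trans (map_zero _).symm))
        rw [hθ] at hb1
        rw [h₁.inj (hb1.trans (map_zero _).symm), map_zero]
      have hN := isShortExact_mkQ hj
      obtain ⟨q, hq⟩ := exists_factorization h₁.surj
        ((LinearMap.range j).mkQ ∘ₗ LinearMap.inl R P₁ P₂) (fun b hb => by
          obtain ⟨a, rfl⟩ := h₁.exists_preimage hb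
          rw [← hN.comp_apply (f a)]
          simp [j, hθ, h.comp_apply])
      obtain ⟨r, hr⟩ := exists_factorization hN.surj (p₂ ∘ₗ LinearMap.snd R P₁ P₂) (fun x hx => by
          obtain ⟨b, rfl⟩ := hN.exists_preimage hx
          simp [j, h₂.comp_apply])
      refine ⟨.of R (P₁ × P₂), .of R ((P₁ × P₂) ⧸ LinearMap.range j), j, _,
        inferInstanceAs (Module.Projective R (P₁ × P₂)), hN, A', C', q, r, ⟨?_, ?_, ?_⟩, hA', hC'⟩
      · rw [injective_iff_map_eq_zero]
        intro a' ha'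
        obtain ⟨x, rfl⟩ := h₁.surj a'
        rw [hq] at ha'
        obtain ⟨b, hb⟩ := hN.exists_preimage ha'
        have hb1 : θ b = x := congrArg Prod.fst hb
        have hb2 : i₂ (g b) = 0 := congrArg Prod.snd hb
        obtain ⟨a, rfl⟩ := h.exists_preimage (h₂.inj (hb2.trans (map_zero _).symm))
        rw [← hb1, hθ, h₁.comp_apply]
      · intro n
        obtain ⟨⟨x, y⟩, rfl⟩ := hN.surj n
        rw [hr]
        constructor
        · intro hy
          obtain ⟨c, hc⟩ := h₂.exists_preimage (b := y) hy
          obtain ⟨b, rfl⟩ := h.surj c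
          refine ⟨p₁ (x - θ b), ?_⟩
          rw [hq, ← sub_eq_zero, LinearMap.comp_apply, ← map_sub,
            ← neg_eq_zero, ← map_neg, ← hN.comp_apply b]
          congr 1
          ext
          · simp [j]
          · simp [j, hc]
        · rintro ⟨a', ha'⟩
          obtain ⟨z, rfl⟩ := h₁.surj a'
          rw [hq] at ha'
          have := hr (x, y)
          rw [← ha'] at this
          rw [← this]
          have := hr (z, 0)
          simpa using this
      · intro c'
        obtain ⟨y, rfl⟩ := h₂.surj c'
        exact ⟨_, hr (0, y)⟩
    · rintro B ⟨A, C, f, g, h, hA, hC⟩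
      obtain ⟨A', P₁, i₁, p₁, hP₁, h₁, hA'⟩ := exists_resolution hA
      obtain ⟨C', P₂, i₂, p₂, hP₂, h₂, hC'⟩ := exists_resolution hC
      obtain ⟨s, hs⟩ := exists_lift hP₂ h.surj p₂
      let j : P₁ × P₂ →ₗ[R] B := (f ∘ₗ p₁).coprod s
      have hj : Function.Surjective j := by
        intro b
        obtain ⟨y, hy⟩ := h₂.surj (g b)
        obtain ⟨a, ha⟩ := h.exists_preimage (b := b - s y) (by simp [hs, hy])
        obtain ⟨x, rfl⟩ := h₁.surj a
        exact ⟨(x, y), by simp [j, ha]⟩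
      have hK := isShortExact_ker hj
      obtain ⟨q, hq⟩ := hK.lift (LinearMap.inl R P₁ P₂ ∘ₗ i₁) (fun a => by
        simp [j, h₁.comp_apply])
      obtain ⟨r, hr⟩ := h₂.lift (LinearMap.snd R P₁ P₂ ∘ₗ (LinearMap.ker j).subtype) (by
        rintro ⟨⟨x, y⟩, hxy⟩
        have := congrArg g (LinearMap.mem_ker.1 hxy)
        simpa [j, hs, h.comp_apply] using this)
      refine ⟨.of R (LinearMap.ker j), .of R (P₁ × P₂), _, j,
        inferInstanceAs (Module.Projective R (P₁ × P₂)), hK, A', C', q, r, ⟨?_, ?_, ?_⟩, hA', hC'⟩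
      · intro a b hab
        have := congrArg Prod.fst ((hq a).symm.trans ((congrArg _ hab).trans (hq b)))
        exact h₁.inj this
      · rintro ⟨⟨x, y⟩, hxy⟩
        have hr' := hr ⟨⟨x, y⟩, hxy⟩
        simp only [LinearMap.comp_apply, Submodule.subtype_apply, LinearMap.snd_apply] at hr'
        constructor
        · intro h0
          rw [h0, map_zero] at hr'
          subst hr'
          have hx : p₁ x = 0 := h.inj (by simpa [j] using hxy)
          obtain ⟨a, rfl⟩ := h₁.exists_preimage hx
          exact ⟨a, Subtype.ext (hq a)⟩
        · rintro ⟨a, ha⟩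
          have hqa := hq a
          rw [ha] at hqa
          have : y = 0 := congrArg Prod.snd hqa
          exact h₂.inj (by rw [hr', this, map_zero])
      · intro c
        obtain ⟨a, ha⟩ := h.exists_preimage (b := s (i₂ c)) (by rw [hs, h₂.comp_apply])
        obtain ⟨x, rfl⟩ := h₁.surj a
        refine ⟨⟨(-x, i₂ c), by simp [j, ha]⟩, h₂.inj ?_⟩
        rw [hr]
        rfl
  exact hX.isGorensteinProjective (M := .of R B) ⟨.of R A, .of R C, f, g, h, hA, hC⟩

theorem isShortExact_inl_snd :
    IsShortExact (LinearMap.inl R A B) (LinearMap.snd R A B) :=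
  ⟨LinearMap.inl_injective, fun x => ⟨fun hx => ⟨x.1, by ext <;> simp_all⟩,
    by rintro ⟨a, rfl⟩; rfl⟩,
    LinearMap.snd_surjective⟩

theorem isGorensteinProjective_prod (hA : IsGorensteinProjective R A)
    (hB : IsGorensteinProjective R B) : IsGorensteinProjective R (A × B) :=
  isGorensteinProjective_of_extension isShortExact_inl_snd hA hB

/-- The pushout of two short exact sequences starting at the same module. -/
theorem exists_pushout {f₁ : A →ₗ[R] B} {g₁ : B →ₗ[R] C} {f₂ : A →ₗ[R] M} {g₂ : M →ₗ[R] N}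
    (h₁ : IsShortExact f₁ g₁) (h₂ : IsShortExact f₂ g₂) :
    ∃ (D : ModuleCat.{u} R) (i₁ : B →ₗ[R] D) (p₁ : D →ₗ[R] N) (i₂ : M →ₗ[R] D) (p₂ : D →ₗ[R] C),
      IsShortExact i₁ p₁ ∧ IsShortExact i₂ p₂ := by
  let j : A →ₗ[R] B × M := f₁.prod (-f₂)
  let π := (LinearMap.range j).mkQ
  have hπ : ∀ x, π x = 0 ↔ ∃ a, j a = x := fun x => by simp [π]
  have hπs : Function.Surjective π := Submodule.mkQ_surjective _
  have hπa : ∀ a, π (f₁ a, 0) = π (0, f₂ a) := fun a => by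
    rw [← sub_eq_zero, ← map_sub, hπ]
    exact ⟨a, by simp [j]⟩
  obtain ⟨p₁, hp₁⟩ := exists_factorization hπs (g₂ ∘ₗ LinearMap.snd R B M) (fun x hx => by
    obtain ⟨a, rfl⟩ := (hπ x).1 hx
    simp [j, h₂.comp_apply])
  obtain ⟨p₂, hp₂⟩ := exists_factorization hπs (g₁ ∘ₗ LinearMap.fst R B M) (fun x hx => by
    obtain ⟨a, rfl⟩ := (hπ x).1 hx
    simp [j, h₁.comp_apply])
  refine ⟨.of R ((B × M) ⧸ LinearMap.range j), π ∘ₗ LinearMap.inl R B M, p₁,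
    π ∘ₗ LinearMap.inr R B M, p₂, ⟨?_, ?_, ?_⟩, ⟨?_, ?_, ?_⟩⟩
  · rw [injective_iff_map_eq_zero]
    intro b hb
    obtain ⟨a, ha⟩ := (hπ _).1 hb
    have ha1 : f₁ a = b := congrArg Prod.fst ha
    have ha2 : -f₂ a = 0 := congrArg Prod.snd ha
    rw [← ha1, h₂.inj ((neg_eq_zero.1 ha2).trans (map_zero _).symm), map_zero]
  · intro d
    obtain ⟨⟨b, m⟩, rfl⟩ := hπs d
    rw [hp₁]
    constructor
    · intro hm
      obtain ⟨a, rfl⟩ := h₂.exists_preimage (b := m) hm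
      refine ⟨b + f₁ a, ?_⟩
      have : ((b, f₂ a) : B × M) = (b, 0) + (0, f₂ a) := by simp
      rw [this, π.map_add, ← hπa, ← π.map_add]
      simp
    · rintro ⟨c, hc⟩
      have := hp₁ (b, m)
      rw [← hc, LinearMap.comp_apply, hp₁] at this
      simpa using this.symm
  · intro n
    obtain ⟨m, rfl⟩ := h₂.surj n
    exact ⟨_, hp₁ (0, m)⟩
  · rw [injective_iff_map_eq_zero]
    intro b hb
    obtain ⟨a, ha⟩ := (hπ _).1 hb
    have ha1 : f₁ a = 0 := congrArg Prod.fst ha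
    have ha2 : -f₂ a = b := congrArg Prod.snd ha
    rw [← ha2, h₁.inj (ha1.trans (map_zero _).symm), map_zero, neg_zero]
  · intro d
    obtain ⟨⟨b, m⟩, rfl⟩ := hπs d
    rw [hp₂]
    constructor
    · intro hm
      obtain ⟨a, rfl⟩ := h₁.exists_preimage (b := b) hm
      refine ⟨f₂ a + m, ?_⟩
      have : ((f₁ a, m) : B × M) = (f₁ a, 0) + (0, m) := by simp
      rw [this, π.map_add, hπa, ← π.map_add]
      simp
    · rintro ⟨c, hc⟩
      have := hp₂ (b, m)
      rw [← hc, LinearMap.comp_apply, hp₂] at this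
      simpa using this.symm
  · intro n
    obtain ⟨m, rfl⟩ := h₁.surj n
    exact ⟨_, hp₂ (m, 0)⟩

theorem isGorensteinProjective_of_prod_projective (hP : Module.Projective R P)
    (hM : IsGorensteinProjective R (M × P)) : IsGorensteinProjective R M := by
  have hX : IsGorensteinClass R (fun M => ∃ P : ModuleCat.{u} R, Module.Projective R P ∧
      IsGorensteinProjective R (M × P)) := by
    refine ⟨?_, ?_, ?_⟩
    · rintro M ⟨P, hP, hM⟩
      exact (isExtPerp_of_isGorensteinProjective hM).of_retract (i := LinearMap.inl R M P)
        (r := LinearMap.fst R M P) (fun _ => rfl)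
    · rintro M ⟨P, hP, hM⟩
      obtain ⟨P₀, G, f, g, hP₀, h, hG⟩ := exists_coresolution hM
      have hj : Function.Injective (f ∘ₗ LinearMap.inl R M P) := h.inj.comp LinearMap.inl_injective
      have hN := isShortExact_mkQ hj
      obtain ⟨p, hp⟩ := exists_factorization hN.surj g (fun x hx => by
        obtain ⟨m, rfl⟩ := hN.exists_preimage hx
        exact h.comp_apply _)
      have hPN : IsShortExact ((LinearMap.range (f ∘ₗ LinearMap.inl R M P)).mkQ ∘ₗ
          f ∘ₗ LinearMap.inr R M P) p := by
        refine ⟨?_, ?_, fun y => ?_⟩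
        · rw [injective_iff_map_eq_zero]
          intro x hx
          obtain ⟨m, hm⟩ := hN.exists_preimage hx
          exact (congrArg Prod.snd (h.inj hm)).symm
        · intro n
          obtain ⟨x, rfl⟩ := hN.surj n
          rw [hp]
          constructor
          · intro hx
            obtain ⟨⟨m, y⟩, rfl⟩ := h.exists_preimage hx
            refine ⟨y, ?_⟩
            have : ((m, y) : M × P) = LinearMap.inl R M P m + LinearMap.inr R M P y := by simp
            rw [this, map_add, map_add]
            have := hN.comp_apply m
            rw [LinearMap.comp_apply] at this
            rw [this, zero_add]
            rfl
          · rintro ⟨y, hy⟩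
            rw [← hp, ← hy]
            simp only [LinearMap.comp_apply]
            rw [hp, h.comp_apply]
        · obtain ⟨x, rfl⟩ := h.surj y
          exact ⟨_, hp x⟩
      have hN' := isGorensteinProjective_of_extension hPN
        (isGorensteinProjective_of_projective hP) hG
      exact ⟨P₀, .of R (P₀ ⧸ LinearMap.range (f ∘ₗ LinearMap.inl R M P)), _, _, hP₀, hN,
        .of R PUnit, inferInstanceAs (Module.Projective R PUnit.{u + 1}),
        isGorensteinProjective_prod hN'
          (isGorensteinProjective_of_projective
            (inferInstanceAs (Module.Projective R PUnit.{u + 1})))⟩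
    · rintro M ⟨P, hP, hM⟩
      obtain ⟨G, P₀, f, g, hP₀, h, hG⟩ := exists_resolution hM
      obtain ⟨P₁, p, hP₁, hp⟩ := exists_projective_cover R M
      have hK := isShortExact_ker hp
      refine ⟨.of R (LinearMap.ker p), P₁, _, p, hP₁, hK, P₀, hP₀, ?_⟩
      obtain ⟨s, hs⟩ := exists_lift hP₀ hp (LinearMap.fst R M P ∘ₗ g)
      have hPP : Module.Projective R (P₁ × P) := inferInstance
      obtain ⟨t, ht⟩ := exists_lift hPP h.surj
        ((p ∘ₗ LinearMap.fst R P₁ P).prod (LinearMap.snd R P₁ P))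
      -- the map `ker p × P₀ → P₁ × P` has kernel `G`
      let q : LinearMap.ker p × P₀ →ₗ[R] P₁ × P :=
        ((LinearMap.ker p).subtype.coprod s).prod
          (LinearMap.snd R M P ∘ₗ g ∘ₗ LinearMap.snd R (LinearMap.ker p) P₀)
      obtain ⟨v, hv⟩ := hK.lift (-(s ∘ₗ f)) (fun x => by simp [hs, h.comp_apply])
      refine isGorensteinProjective_of_extension (f := v.prod f) (g := q) ⟨?_, ?_, ?_⟩ hG
        (isGorensteinProjective_of_projective hPP)
      · exact fun x y hxy => h.inj (congrArg Prod.snd hxy)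
      · rintro ⟨k, x⟩
        constructor
        · intro hx
          have h1 : (k : P₁) + s x = 0 := congrArg Prod.fst hx
          have h2 : (g x).2 = 0 := congrArg Prod.snd hx
          have h3 : (g x).1 = 0 := by
            have := congrArg p h1
            simpa [hs] using this
          obtain ⟨y, rfl⟩ := h.exists_preimage (b := x) (Prod.ext h3 h2)
          refine ⟨y, Prod.ext (Subtype.ext ?_) rfl⟩
          rw [eq_neg_of_add_eq_zero_left h1]
          exact hv y
        · rintro ⟨y, hy⟩
          have h1 : v y = k := congrArg Prod.fst hy
          have h2 : f y = x := congrArg Prod.snd hy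
          subst h1 h2
          have := hv y
          simp only [Submodule.subtype_apply] at this
          ext
          · simp [q, this]
          · simp [q, h.comp_apply]
      · rintro ⟨x, y⟩
        obtain ⟨z, hz⟩ := h.surj (p x, y)
        refine ⟨(⟨x - s z, by simp [hs, hz]⟩, z), ?_⟩
        ext
        · simp [q]
        · simp [q, hz]
  exact hX.isGorensteinProjective (M := .of R M) ⟨.of R P, hP, hM⟩

theorem IsExtPerp.exists_equiv_prod (hC : IsExtPerp R C) (hP : Module.Projective R P)
    {f : P →ₗ[R] B} {g : B →ₗ[R] C} (h : IsShortExact f g) : Nonempty ((C × P) ≃ₗ[R] B) := by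
  obtain ⟨r, hr⟩ := hC.exists_extension h (LinearMap.id (R := R) (M := P))
  replace hr : ∀ x, r (f x) = x := fun x => LinearMap.congr_fun hr x
  refine ⟨(LinearEquiv.ofBijective (g.prod r) ⟨?_, ?_⟩).symm⟩
  · rw [injective_iff_map_eq_zero]
    intro b hb
    obtain ⟨x, rfl⟩ := h.exists_preimage (b := b) (congrArg Prod.fst hb)
    have : r (f x) = 0 := congrArg Prod.snd hb
    rw [← hr x, this, map_zero]
  · rintro ⟨c, x⟩
    obtain ⟨b, rfl⟩ := h.surj c
    exact ⟨b + f (x - r b), Prod.ext (by simp [h.comp_apply]) (by simp [hr])⟩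

/-- The cokernel of a monomorphism between Gorenstein projective modules is Gorenstein projective
as soon as it has no extensions by projective modules. -/
theorem isGorensteinProjective_of_mono {f : A →ₗ[R] B} {g : B →ₗ[R] C}
    (h : IsShortExact f g) (hA : IsGorensteinProjective R A) (hB : IsGorensteinProjective R B)
    (hC : IsExtPerp R C) : IsGorensteinProjective R C := by
  obtain ⟨P, A', i, p, hP, h', hA'⟩ := exists_coresolution hA
  obtain ⟨D, i₁, p₁, i₂, p₂, h₁, h₂⟩ := exists_pushout h h'
  obtain ⟨e⟩ := hC.exists_equiv_prod hP h₂
  exact isGorensteinProjective_of_prod_projective hP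
    (isGorensteinProjective_of_equiv e (isGorensteinProjective_of_extension h₁ hB hA'))

/-- Gorenstein projective modules are closed under kernels of epimorphisms. -/
theorem isGorensteinProjective_of_epi {f : A →ₗ[R] B} {g : B →ₗ[R] C}
    (h : IsShortExact f g) (hB : IsGorensteinProjective R B) (hC : IsGorensteinProjective R C) :
    IsGorensteinProjective R A := by
  obtain ⟨C', P, i, p, hP, h', hC'⟩ := exists_resolution hC
  obtain ⟨s, hs⟩ := exists_lift hP h.surj p
  obtain ⟨t, ht⟩ := h.lift (-(s ∘ₗ i)) (fun x => by simp [hs, h'.comp_apply])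
  refine isGorensteinProjective_of_prod_projective hP
    (isGorensteinProjective_of_extension (f := t.prod i) (g := f.coprod s) ⟨?_, ?_, ?_⟩ hC' hB)
  · exact fun x y hxy => h'.inj (congrArg Prod.snd hxy)
  · rintro ⟨a, x⟩
    simp only [LinearMap.coprod_apply]
    constructor
    · intro hx
      have : p x = 0 := by
        have := congrArg g hx
        simpa [hs, h.comp_apply] using this
      obtain ⟨y, rfl⟩ := h'.exists_preimage this
      refine ⟨y, Prod.ext (h.inj ?_) rfl⟩
      rw [eq_neg_of_add_eq_zero_left hx]
      exact ht y
    · rintro ⟨y, hy⟩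
      obtain ⟨rfl, rfl⟩ := Prod.ext_iff.1 hy
      simp [ht]
  · intro b
    obtain ⟨x, hx⟩ := h'.surj (g b)
    obtain ⟨a, ha⟩ := h.exists_preimage (b := b - s x) (by simp [hs, hx])
    exact ⟨(a, x), by simp [ha]⟩

theorem gProjDimLE_of_isGorensteinProjective (n : ℕ) (hM : IsGorensteinProjective R M) :
    GProjDimLE R n M := by
  cases n with
  | zero => exact hM
  | succ n => exact Or.inl hM

theorem gProjDimLE_of_equiv (n : ℕ) (e : M ≃ₗ[R] N) (hN : GProjDimLE R n N) :
    GProjDimLE R n M := by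
  induction n generalizing M N with
  | zero => exact isGorensteinProjective_of_equiv e hN
  | succ n ih =>
    rcases hN with hN | ⟨G, f, hG, hf, h⟩
    · exact Or.inl (isGorensteinProjective_of_equiv e hN)
    · refine Or.inr ⟨G, e.symm.toLinearMap ∘ₗ f, hG, e.symm.surjective.comp hf, ?_⟩
      exact ih (LinearEquiv.ofEq _ _ (by ext; simp)) h

theorem IsShortExact.equiv_ker {f : A →ₗ[R] B} {g : B →ₗ[R] C} (h : IsShortExact f g) :
    Nonempty (A ≃ₗ[R] LinearMap.ker g) :=
  ⟨(LinearEquiv.ofInjective f h.inj).trans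
    (LinearEquiv.ofEq _ _ (by ext x; exact (h.exact x).symm))⟩

theorem gProjDimLE_succ_of_isShortExact (n : ℕ) {f : A →ₗ[R] B} {g : B →ₗ[R] C}
    (h : IsShortExact f g) (hB : IsGorensteinProjective R B) (hA : GProjDimLE R n A) :
    GProjDimLE R (n + 1) C := by
  obtain ⟨e⟩ := h.equiv_ker
  exact Or.inr ⟨.of R B, g, hB, h.surj, gProjDimLE_of_equiv n e.symm hA⟩

theorem gProjDimLE_ker (n : ℕ) (hM : GProjDimLE R (n + 1) M) (hP : Module.Projective R P)
    {g : P →ₗ[R] M} (hg : Function.Surjective g) : GProjDimLE R n (LinearMap.ker g) := by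
  have hgp := isGorensteinProjective_of_projective hP
  rcases hM with hM | ⟨G, p, hG, hp, hK⟩
  · exact gProjDimLE_of_isGorensteinProjective n
      (isGorensteinProjective_of_epi (isShortExact_ker hg) hgp hM)
  -- cover `G` by `L × P` for every epimorphism `L → ker p`
  obtain ⟨s, hs⟩ := exists_lift hP hp g
  have cover : ∀ (L : ModuleCat.{u} R) (q : L →ₗ[R] LinearMap.ker p), Function.Surjective q →
      IsGorensteinProjective R L → ∃ (T : ModuleCat.{u} R) (r : T →ₗ[R] LinearMap.ker g),
        IsGorensteinProjective R T ∧ Function.Surjective r ∧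
          Nonempty (LinearMap.ker r ≃ₗ[R] LinearMap.ker q) := by
    intro L q hq hL
    let j : L × P →ₗ[R] G := ((LinearMap.ker p).subtype ∘ₗ q).coprod s
    have hj : Function.Surjective j := by
      intro x
      obtain ⟨y, hy⟩ := hg (p x)
      obtain ⟨l, hl⟩ := hq ⟨x - s y, by simp [hs, hy]⟩
      exact ⟨(l, y), by simp [j, hl]⟩
    obtain ⟨r, hr⟩ := (isShortExact_ker hg).lift
      (LinearMap.snd R L P ∘ₗ (LinearMap.ker j).subtype) (by
        rintro ⟨⟨l, y⟩, hly⟩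
        have := congrArg p (LinearMap.mem_ker.1 hly)
        simpa [j, hs] using this)
    replace hr : ∀ x, (r x : P) = x.1.2 := hr
    refine ⟨.of R (LinearMap.ker j), r, isGorensteinProjective_of_epi (isShortExact_ker hj)
      (isGorensteinProjective_prod hL hgp) hG, ?_, ?_⟩
    · rintro ⟨y, hy⟩
      obtain ⟨l, hl⟩ := hq ⟨-s y, by simpa [hs] using hy⟩
      exact ⟨⟨(l, y), by simp [j, hl]⟩, Subtype.ext (hr _)⟩
    · let ι : LinearMap.ker q →ₗ[R] LinearMap.ker j :=
        (LinearMap.inl R L P ∘ₗ (LinearMap.ker q).subtype).codRestrict _ (fun x => by simp [j])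
      have hι : IsShortExact ι r.rangeRestrict := by
        refine ⟨?_, ?_, r.surjective_rangeRestrict⟩
        · intro x y hxy
          have := congrArg (fun z => z.1.1) hxy
          exact Subtype.ext this
        · rintro ⟨⟨l, y⟩, hly⟩
          have hr' := hr ⟨(l, y), hly⟩
          constructor
          · intro h0
            have h0 : r ⟨(l, y), hly⟩ = 0 := congrArg Subtype.val h0
            rw [h0] at hr'
            have hy : y = 0 := hr'.symm
            subst hy
            have : q l = 0 := Subtype.ext (by simpa [j] using hly)
            exact ⟨⟨l, this⟩, rfl⟩
          · rintro ⟨x, hx⟩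
            have : y = 0 := (congrArg (fun z => z.1.2) hx).symm
            exact Subtype.ext (Subtype.ext (hr'.trans this))
      obtain ⟨e⟩ := hι.equiv_ker
      exact ⟨(e.trans (LinearEquiv.ofEq _ _ (LinearMap.ker_rangeRestrict r))).symm⟩
  have base : IsGorensteinProjective R (LinearMap.ker p) →
      IsGorensteinProjective R (LinearMap.ker g) := by
    intro h
    obtain ⟨T, r, hT, hr, ⟨e⟩⟩ := cover (.of R (LinearMap.ker p)) LinearMap.id
      Function.surjective_id h
    refine isGorensteinProjective_of_equiv (LinearEquiv.ofBijective r ⟨?_, hr⟩).symm hT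
    rw [← LinearMap.ker_eq_bot, ← Submodule.subsingleton_iff_eq_bot]
    have : Subsingleton (LinearMap.ker (LinearMap.id (R := R) (M := LinearMap.ker p))) := by
      rw [Submodule.subsingleton_iff_eq_bot, LinearMap.ker_id]
    exact e.toEquiv.subsingleton
  cases n with
  | zero => exact base hK
  | succ n =>
    rcases hK with hK | ⟨L, q, hL, hq, hK⟩
    · exact Or.inl (base hK)
    · obtain ⟨T, r, hT, hr, ⟨e⟩⟩ := cover L q hq hL
      exact Or.inr ⟨T, r, hT, hr, gProjDimLE_of_equiv n e hK⟩

end Modules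

section Hopf

open Coalgebra MulOpposite

variable (k H : Type u) [Field k] [Ring H] [HopfAlgebra k H]

/-- The antipode as an algebra homomorphism to the opposite algebra. -/
noncomputable def antipodeOp : H →ₐ[k] Hᵐᵒᵖ :=
  AlgHom.ofLinearMap ((opLinearEquiv k).toLinearMap ∘ₗ HopfAlgebra.antipode k)
    (by simp) (fun a b => by simp [HopfAlgebra.antipode_mul_antidistrib])

/-- The algebra homomorphism `H → Hᵉ`, `h ↦ ∑ h₁ ⊗ S(h₂)`. -/
noncomputable def toEnveloping : H →ₐ[k] H ⊗[k] Hᵐᵒᵖ :=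
  (Algebra.TensorProduct.map (AlgHom.id k H) (antipodeOp k H)).comp (Bialgebra.comulAlgHom k H)

variable {k H}

theorem toEnveloping_apply {ι : Type*} {a : H} (r : Coalgebra.Repr k a ι) :
    toEnveloping k H a =
      ∑ i ∈ r.index, r.left i ⊗ₜ op (HopfAlgebra.antipode k (r.right i)) := by
  simp only [toEnveloping, AlgHom.comp_apply, Bialgebra.comulAlgHom_apply, ← r.eq, map_sum]
  rfl

theorem sum_tmul_apply_comul {V : Type*} [AddCommGroup V] [Module k V] (g : H ⊗[k] H →ₗ[k] V)
    (v : V) (hg : ∀ h : H, g (comul h) = counit (R := k) h • v) {ι : Type*} {a : H}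
    (r : Coalgebra.Repr k a ι) :
    ∑ i ∈ r.index, ∑ j ∈ (ℛ k (r.left i)).index,
      (ℛ k (r.left i)).left j ⊗ₜ[k] g ((ℛ k (r.left i)).right j ⊗ₜ r.right i) = a ⊗ₜ v := by
  have h1 := congrArg (g.lTensor H) (coassoc_apply (R := k) a)
  have h2 : g ∘ₗ comul = LinearMap.toSpanSingleton k V v ∘ₗ counit := LinearMap.ext hg
  rw [← LinearMap.lTensor_comp_apply, h2, LinearMap.lTensor_comp_apply, lTensor_counit_comul] at h1
  simp only [LinearMap.lTensor_tmul, LinearMap.toSpanSingleton_apply, one_smul] at h1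
  rw [← h1, ← r.eq, map_sum, map_sum, map_sum]
  refine Finset.sum_congr rfl fun i _ => ?_
  rw [LinearMap.rTensor_tmul, ← (ℛ k (r.left i)).eq, TensorProduct.sum_tmul, map_sum, map_sum]
  rfl

theorem mul_map_antipode_id_comul (h : H) :
    (LinearMap.mul' k H ∘ₗ TensorProduct.map (HopfAlgebra.antipode k) LinearMap.id) (comul h) =
      counit (R := k) h • (1 : H) := by
  rw [← Algebra.algebraMap_eq_smul_one]
  exact HopfAlgebra.mul_antipode_rTensor_comul_apply h

theorem mul_map_id_antipode_comul (h : H) :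
    (LinearMap.mul' k H ∘ₗ TensorProduct.map LinearMap.id (HopfAlgebra.antipode k)) (comul h) =
      counit (R := k) h • (1 : H) := by
  rw [← Algebra.algebraMap_eq_smul_one]
  exact HopfAlgebra.mul_antipode_lTensor_comul_apply h

theorem sum_mul_toEnveloping {ι : Type*} {a : H} (r : Coalgebra.Repr k a ι) :
    ∑ i ∈ r.index, (1 ⊗ₜ op (r.right i) : H ⊗[k] Hᵐᵒᵖ) * toEnveloping k H (r.left i) =
      a ⊗ₜ 1 := by
  rw [← sum_tmul_apply_comul ((opLinearEquiv k).toLinearMap ∘ₗ LinearMap.mul' k H ∘ₗ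
    TensorProduct.map (HopfAlgebra.antipode k) LinearMap.id) 1 (fun h => by
      rw [LinearMap.comp_apply, mul_map_antipode_id_comul]; simp) r]
  refine Finset.sum_congr rfl fun i _ => ?_
  rw [toEnveloping_apply (ℛ k (r.left i)), Finset.mul_sum]
  refine Finset.sum_congr rfl fun j _ => ?_
  simp

variable (k H) in
/-- The `H`-linear map `H ⊗ H → Hᵉ`, `a ⊗ b ↦ ∑ a₁ ⊗ b S(a₂)`. -/
noncomputable def twist : H ⊗[k] H →ₗ[k] H ⊗[k] Hᵐᵒᵖ :=
  TensorProduct.lift ((LinearMap.mul k (H ⊗[k] Hᵐᵒᵖ)).compl₁₂ (toEnveloping k H).toLinearMap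
    (TensorProduct.mk k H Hᵐᵒᵖ 1 ∘ₗ (opLinearEquiv k).toLinearMap))

variable (k H) in
/-- The map `Hᵉ → H ⊗ H`, `a ⊗ b ↦ ∑ a₁ ⊗ b S²(a₂)`, inverse to `twist`. -/
noncomputable def untwist : H ⊗[k] Hᵐᵒᵖ →ₗ[k] H ⊗[k] H :=
  (LinearMap.mul' k H ∘ₗ (TensorProduct.comm k H H).toLinearMap ∘ₗ
      TensorProduct.map (HopfAlgebra.antipode k ∘ₗ HopfAlgebra.antipode k)
        LinearMap.id).lTensor H ∘ₗ (TensorProduct.assoc k H H H).toLinearMap ∘ₗ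
    TensorProduct.map comul (opLinearEquiv k).symm.toLinearMap

theorem twist_tmul (a b : H) :
    twist k H (a ⊗ₜ b) = toEnveloping k H a * (1 ⊗ₜ op b) := rfl

theorem untwist_tmul {ι : Type*} {a : H} (r : Coalgebra.Repr k a ι) (b : H) :
    untwist k H (a ⊗ₜ op b) = ∑ i ∈ r.index, r.left i ⊗ₜ
      (b * HopfAlgebra.antipode k (HopfAlgebra.antipode k (r.right i))) := by
  simp only [untwist, LinearMap.comp_apply, TensorProduct.map_tmul, ← r.eq, TensorProduct.sum_tmul,
    map_sum, LinearEquiv.coe_coe]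
  rfl

theorem twist_untwist (t : H ⊗[k] Hᵐᵒᵖ) : twist k H (untwist k H t) = t := by
  suffices h : twist k H ∘ₗ untwist k H = LinearMap.id from LinearMap.congr_fun h t
  refine TensorProduct.ext' fun a b => ?_
  obtain ⟨b, rfl⟩ := op_surjective b
  let r := ℛ k a
  rw [LinearMap.comp_apply, untwist_tmul r, map_sum]
  refine Eq.trans ?_ (sum_tmul_apply_comul ((opLinearEquiv k).toLinearMap ∘ₗ
    LinearMap.mulLeft k b ∘ₗ HopfAlgebra.antipode k ∘ₗ LinearMap.mul' k H ∘ₗ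
    TensorProduct.map LinearMap.id (HopfAlgebra.antipode k)) (op b) (fun h => by
      have := mul_map_id_antipode_comul (k := k) h
      simp only [LinearMap.comp_apply] at this ⊢
      simp [this]) r)
  refine Finset.sum_congr rfl fun i _ => ?_
  rw [twist_tmul, toEnveloping_apply (ℛ k (r.left i)), Finset.sum_mul]
  refine Finset.sum_congr rfl fun j _ => ?_
  simp [HopfAlgebra.antipode_mul_antidistrib, mul_assoc]

theorem untwist_twist (t : H ⊗[k] H) : untwist k H (twist k H t) = t := by
  suffices h : untwist k H ∘ₗ twist k H = LinearMap.id from LinearMap.congr_fun h t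
  refine TensorProduct.ext' fun a b => ?_
  let r := ℛ k a
  rw [LinearMap.comp_apply, twist_tmul, toEnveloping_apply r, Finset.sum_mul, map_sum]
  refine Eq.trans ?_ (sum_tmul_apply_comul (LinearMap.mulLeft k b ∘ₗ
    HopfAlgebra.antipode k ∘ₗ LinearMap.mul' k H ∘ₗ
    TensorProduct.map (HopfAlgebra.antipode k) LinearMap.id) b (fun h => by
      have := mul_map_antipode_id_comul (k := k) h
      simp only [LinearMap.comp_apply] at this ⊢
      simp [this]) r)
  refine Finset.sum_congr rfl fun i _ => ?_
  rw [Algebra.TensorProduct.tmul_mul_tmul, mul_one, ← op_mul, untwist_tmul (ℛ k (r.left i))]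
  refine Finset.sum_congr rfl fun j _ => ?_
  simp [HopfAlgebra.antipode_mul_antidistrib, mul_assoc]

variable (k H) in
/-- A left `Hᵉ`-module, viewed as a left `H`-module through `toEnveloping`. -/
def Restricted (Q : Type u) : Type u := (fun _ _ => Q) k H

section Restricted

variable (Q Q' : Type u) [AddCommGroup Q] [Module (H ⊗[k] Hᵐᵒᵖ) Q]
  [AddCommGroup Q'] [Module (H ⊗[k] Hᵐᵒᵖ) Q']

instance : AddCommGroup (Restricted k H Q) := inferInstanceAs (AddCommGroup Q)

instance : Module (H ⊗[k] Hᵐᵒᵖ) (Restricted k H Q) :=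
  inferInstanceAs (Module (H ⊗[k] Hᵐᵒᵖ) Q)

noncomputable instance : Module H (Restricted k H Q) :=
  Module.compHom Q (toEnveloping k H).toRingHom

variable {Q Q'}

/-- Restriction of linear maps along `toEnveloping`. -/
def Restricted.map (f : Q →ₗ[H ⊗[k] Hᵐᵒᵖ] Q') : Restricted k H Q →ₗ[H] Restricted k H Q' where
  toFun := f
  map_add' := f.map_add
  map_smul' h q := f.map_smul (toEnveloping k H h) q

theorem twist_smul (h : H) (t : H ⊗[k] H) :
    twist k H (h • t) = toEnveloping k H h * twist k H t := by
  induction t with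
  | zero => simp
  | add x y hx hy => rw [smul_add, map_add, map_add, hx, hy, mul_add]
  | tmul a b =>
    rw [TensorProduct.smul_tmul', twist_tmul, twist_tmul, smul_eq_mul, map_mul, mul_assoc]

variable (k H) in
theorem Restricted.projective_self :
    Module.Projective H (Restricted k H (H ⊗[k] Hᵐᵒᵖ)) := by
  let e : (H ⊗[k] H) →ₗ[H] Restricted k H (H ⊗[k] Hᵐᵒᵖ) :=
    { toFun := twist k H
      map_add' := (twist k H).map_add
      map_smul' := twist_smul }
  exact Module.Projective.of_equiv (LinearEquiv.ofBijective e
    ⟨Function.LeftInverse.injective untwist_twist, Function.RightInverse.surjective twist_untwist⟩)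

theorem Restricted.projective (hQ : Module.Projective (H ⊗[k] Hᵐᵒᵖ) Q) :
    Module.Projective H (Restricted k H Q) := by
  classical
  obtain ⟨s, hs⟩ := hQ.out
  have := Restricted.projective_self k H
  have := Module.Projective.of_equiv (finsuppLequivDFinsupp (ι := Q) (R := H)
    (M := Restricted k H (H ⊗[k] Hᵐᵒᵖ))).symm
  let i : Restricted k H Q →ₗ[H] (Q →₀ Restricted k H (H ⊗[k] Hᵐᵒᵖ)) :=
    { toFun := s
      map_add' := s.map_add
      map_smul' := fun h q => s.map_smul (toEnveloping k H h) q }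
  let p : (Q →₀ Restricted k H (H ⊗[k] Hᵐᵒᵖ)) →ₗ[H] Restricted k H Q :=
    { toFun := Finsupp.linearCombination (H ⊗[k] Hᵐᵒᵖ) (id : Q → Q)
      map_add' := map_add _
      map_smul' := fun h q => (Finsupp.linearCombination (H ⊗[k] Hᵐᵒᵖ) (id : Q → Q)).map_smul
        (toEnveloping k H h) q }
  exact Module.Projective.of_split i p (LinearMap.ext hs)

end Restricted

section Induced

variable (k H)
variable (M N : Type u) [AddCommGroup M] [Module k M] [Module H M] [IsScalarTower k H M]
  [AddCommGroup N] [Module k N] [Module H N] [IsScalarTower k H N]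
  (Q : Type u) [AddCommGroup Q] [Module (H ⊗[k] Hᵐᵒᵖ) Q]

variable {M} in
theorem tensorRep_tmul {ι : Type*} {a : H} (r : Coalgebra.Repr k a ι) (m : M) (x : H) :
    tensorRep k H M H a (m ⊗ₜ x) = ∑ i ∈ r.index, (r.left i • m) ⊗ₜ (r.right i * x) := by
  simp only [tensorRep, AlgHom.comp_apply, Bialgebra.comulAlgHom_apply, ← r.eq, map_sum,
    LinearMap.sum_apply]
  rfl

/-- The right multiplication action of `H` on the second factor of `M ⊗ H`. -/
noncomputable def rightRep : Hᵐᵒᵖ →ₐ[k] Module.End k (M ⊗[k] H) :=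
  (Module.End.lTensorAlgHom k H M).comp (Algebra.lsmul k k H)

/-- The action of `Hᵉ` on `M ⊗ H` given by `h'(m ⊗ h)h'' = ∑ h'₁ m ⊗ h'₂ h h''`. -/
noncomputable def envelopingRep : H ⊗[k] Hᵐᵒᵖ →ₐ[k] Module.End k (M ⊗[k] H) :=
  Algebra.TensorProduct.lift (tensorRep k H M H) (rightRep k H M) fun a b => by
    refine TensorProduct.ext' fun m x => ?_
    have h1 : ∀ (m : M) (x : H), rightRep k H M b (m ⊗ₜ x) = m ⊗ₜ (x * b.unop) := fun _ _ => rfl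
    simp only [Module.End.mul_apply, h1, tensorRep_tmul k H (ℛ k a), map_sum, mul_assoc]

/-- The `k`-module `M ⊗ H`, to be regarded as a left `Hᵉ`-module. -/
def Induced : Type u := M ⊗[k] H

noncomputable instance : AddCommGroup (Induced k H M) := inferInstanceAs (AddCommGroup (M ⊗[k] H))

noncomputable instance : Module (H ⊗[k] Hᵐᵒᵖ) (Induced k H M) :=
  Module.compHom (M ⊗[k] H) (envelopingRep k H M).toRingHom

variable {k M N Q}

namespace Induced

variable (k) in
/-- Pure tensors in the induced module. -/
noncomputable def tmul (m : M) (x : H) : Induced k H M := (m ⊗ₜ[k] x : M ⊗[k] H)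

variable {H}

theorem smul_tmul (a b : H) (m : M) (x : H) :
    (a ⊗ₜ[k] op b) • tmul k H m x = (tensorRep k H M H a (m ⊗ₜ (x * b)) : M ⊗[k] H) := rfl

theorem smul_tmul_eq_sum {ι : Type*} {a : H} (r : Coalgebra.Repr k a ι) (b : H) (m : M) (x : H) :
    (a ⊗ₜ[k] op b) • tmul k H m x =
      ∑ i ∈ r.index, tmul k H (r.left i • m) (r.right i * (x * b)) :=
  (smul_tmul a b m x).trans (tensorRep_tmul k H r m (x * b))

theorem one_tmul_op_smul_tmul (b : H) (m : M) (x : H) :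
    ((1 : H) ⊗ₜ[k] op b) • tmul k H m x = tmul k H m (x * b) := by
  rw [smul_tmul, map_one]
  rfl

omit [Module H M] [IsScalarTower k H M] in
@[elab_as_elim]
theorem induction {motive : Induced k H M → Prop} (t : Induced k H M) (zero : motive 0)
    (tmul : ∀ m x, motive (tmul k H m x)) (add : ∀ x y, motive x → motive y → motive (x + y)) :
    motive t :=
  TensorProduct.induction_on (R := k) t zero tmul add

theorem toEnveloping_smul_tmul {ι : Type*} {a : H} (r : Coalgebra.Repr k a ι) (m : M) (x : H) :
    toEnveloping k H a • tmul k H m x = ∑ i ∈ r.index, ∑ j ∈ (ℛ k (r.left i)).index,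
      tmul k H ((ℛ k (r.left i)).left j • m)
        ((ℛ k (r.left i)).right j * (x * HopfAlgebra.antipode k (r.right i))) := by
  rw [toEnveloping_apply r, Finset.sum_smul]
  exact Finset.sum_congr rfl fun i _ => smul_tmul_eq_sum _ _ _ _

theorem hom_ext {f g : Induced k H M →ₗ[H ⊗[k] Hᵐᵒᵖ] Q}
    (h : ∀ m, f (tmul k H m 1) = g (tmul k H m 1)) : f = g := by
  refine LinearMap.ext fun t => ?_
  induction t using induction with
  | zero => simp
  | add x y hx hy => rw [map_add, map_add, hx, hy]
  | tmul m x => rw [← one_mul x, ← one_tmul_op_smul_tmul, map_smul, map_smul, h]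

theorem map_smul_of_map_tmul_smul (f : Induced k H M →+ Q)
    (h : ∀ (a b : H) (m : M) (x : H),
      f ((a ⊗ₜ[k] op b) • tmul k H m x) = (a ⊗ₜ[k] op b) • f (tmul k H m x))
    (s : H ⊗[k] Hᵐᵒᵖ) (t : Induced k H M) : f (s • t) = s • f t := by
  induction s with
  | zero =>
    exact (congrArg f (zero_smul (H ⊗[k] Hᵐᵒᵖ) t)).trans
      ((map_zero f).trans (zero_smul (H ⊗[k] Hᵐᵒᵖ) (f t)).symm)
  | add s s' hs hs' => rw [add_smul, map_add, hs, hs', add_smul]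
  | tmul a b =>
    induction t using induction with
    | zero => rw [smul_zero, map_zero, smul_zero]
    | add x y hx hy => rw [smul_add, map_add, hx, hy, map_add, smul_add]
    | tmul m x => exact h a b.unop m x

/-- The additive map underlying the functoriality of induction. -/
noncomputable def mapHom (f : M →ₗ[H] N) : Induced k H M →+ Induced k H N :=
  ((f.restrictScalars k).rTensor H).toAddMonoidHom

theorem mapHom_tmul (f : M →ₗ[H] N) (m : M) (x : H) :
    mapHom (k := k) f (tmul k H m x) = tmul k H (f m) x := rfl

/-- Functoriality of induction. -/
noncomputable def map (f : M →ₗ[H] N) : Induced k H M →ₗ[H ⊗[k] Hᵐᵒᵖ] Induced k H N where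
  toFun := mapHom f
  map_add' := map_add _
  map_smul' := map_smul_of_map_tmul_smul (mapHom f) fun a b m x => by
    rw [mapHom_tmul, smul_tmul_eq_sum (ℛ k a), smul_tmul_eq_sum (ℛ k a), map_sum]
    simp only [mapHom_tmul, map_smul]

theorem map_tmul (f : M →ₗ[H] N) (m : M) (x : H) :
    map (k := k) f (tmul k H m x) = tmul k H (f m) x := rfl

/-- The unit of the adjunction between induction and restriction. -/
noncomputable def unit : M →ₗ[H] Restricted k H (Induced k H M) where
  toFun m := tmul k H m 1
  map_add' m m' := TensorProduct.add_tmul m m' 1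
  map_smul' h m := by
    have key := congrArg ((LinearMap.toSpanSingleton H M m).restrictScalars k |>.rTensor H)
      (sum_tmul_apply_comul _ _ mul_map_id_antipode_comul (ℛ k h))
    simp only [map_sum] at key
    refine key.symm.trans (Eq.trans ?_ (toEnveloping_smul_tmul (ℛ k h) m 1).symm)
    refine Finset.sum_congr rfl fun i _ => Finset.sum_congr rfl fun j _ => ?_
    rw [one_mul]
    rfl

variable (k H M) in
/-- The map `m ⊗ x ↦ ε(x) m` as an additive homomorphism. -/
noncomputable def augmentHom : Induced k H M →+ M :=
  (TensorProduct.lift ((LinearMap.lsmul k M).flip.compl₂ counit)).toAddMonoidHom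

omit [Module H M] [IsScalarTower k H M] in
theorem augmentHom_tmul (m : M) (x : H) :
    augmentHom k H M (tmul k H m x) = counit (R := k) x • m := rfl

theorem augmentHom_toEnveloping_smul (h : H) (t : Induced k H M) :
    augmentHom k H M (toEnveloping k H h • t) = h • augmentHom k H M t := by
  induction t using induction with
  | zero => simp
  | add x y hx hy => rw [smul_add, map_add, hx, hy, map_add, smul_add]
  | tmul m x =>
    have key := congrArg (TensorProduct.lift ((LinearMap.lsmul k M).flip ∘ₗ
        (LinearMap.toSpanSingleton H M m).restrictScalars k))
      (sum_tmul_apply_comul (counit (R := k) x • counit (R := k) ∘ₗ LinearMap.mul' k H ∘ₗ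
        TensorProduct.map LinearMap.id (HopfAlgebra.antipode k)) (counit (R := k) x)
        (fun h => by
          have := mul_map_id_antipode_comul (k := k) h
          simp only [LinearMap.comp_apply, LinearMap.smul_apply] at this ⊢
          simp [this, mul_comm]) (ℛ k h))
    simp only [map_sum] at key
    rw [toEnveloping_smul_tmul (ℛ k h), augmentHom_tmul]
    simp only [map_sum, augmentHom_tmul]
    simp at key
    rw [smul_comm, ← key]
    refine Finset.sum_congr rfl fun i _ => Finset.sum_congr rfl fun j _ => ?_
    simp [mul_left_comm, mul_comm]

variable (k) in
/-- The retraction `m ⊗ x ↦ ε(x) m` of the unit. -/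
noncomputable def augment : Restricted k H (Induced k H M) →ₗ[H] M where
  toFun := augmentHom k H M
  map_add' := map_add (augmentHom k H M)
  map_smul' := augmentHom_toEnveloping_smul

theorem augment_unit (m : M) : augment k (unit (k := k) (H := H) m) = m := by
  refine (augmentHom_tmul m 1).trans ?_
  simp

theorem augment_map (f : M →ₗ[H] N) (t : Induced k H M) :
    augment k (map (k := k) f t) = f (augment k t) := by
  change augmentHom k H N (map f t) = f (augmentHom k H M t)
  induction t using induction with
  | zero => simp
  | add x y hx hy => simp only [map_add, hx, hy]
  | tmul m x =>
    rw [map_tmul]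
    exact (map_smul (f.restrictScalars k) (counit (R := k) x) m).symm

/-- The additive map `m ⊗ x ↦ (1 ⊗ x) ψ(m)` out of an induced module. -/
noncomputable def descHom (ψ : M →+ Q)
    (hψ : ∀ (h : H) (m : M), ψ (h • m) = toEnveloping k H h • ψ m) :
    Induced k H M →+ Q :=
  TensorProduct.liftAddHom (AddMonoidHom.mk' (fun m => AddMonoidHom.mk'
    (fun x => ((1 : H) ⊗ₜ[k] op x) • ψ m)
    (fun x y => by rw [op_add, TensorProduct.tmul_add, add_smul]))
    (fun m m' => by
      ext x
      simp)) (by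
    intro c m x
    have h1 : ψ (c • m) = algebraMap k (H ⊗[k] Hᵐᵒᵖ) c • ψ m := by
      rw [← algebraMap_smul H c m, hψ, AlgHom.commutes]
    simp only [AddMonoidHom.mk'_apply]
    rw [h1, smul_smul, ← Algebra.commutes, ← Algebra.smul_def, ← TensorProduct.tmul_smul, op_smul])

theorem descHom_tmul (ψ : M →+ Q) (hψ : ∀ (h : H) (m : M), ψ (h • m) = toEnveloping k H h • ψ m)
    (m : M) (x : H) : descHom ψ hψ (tmul k H m x) = ((1 : H) ⊗ₜ[k] op x) • ψ m := rfl

theorem descHom_smul (ψ : M →+ Q) (hψ : ∀ (h : H) (m : M), ψ (h • m) = toEnveloping k H h • ψ m)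
    (s : H ⊗[k] Hᵐᵒᵖ) (t : Induced k H M) : descHom ψ hψ (s • t) = s • descHom ψ hψ t := by
  refine map_smul_of_map_tmul_smul _ (fun a b m x => ?_) s t
  have h (i : H × H) : (1 : H) ⊗ₜ[k] op ((ℛ k a).right i * (x * b)) *
      toEnveloping k H ((ℛ k a).left i) = (1 ⊗ₜ[k] op (x * b)) *
        (1 ⊗ₜ[k] op ((ℛ k a).right i) * toEnveloping k H ((ℛ k a).left i)) := by
    rw [← mul_assoc (1 ⊗ₜ[k] op (x * b)), Algebra.TensorProduct.tmul_mul_tmul, one_mul, ← op_mul]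
  rw [smul_tmul_eq_sum (ℛ k a), map_sum]
  simp only [descHom_tmul, hψ, smul_smul]
  rw [← Finset.sum_smul]
  congr 1
  simp only [h]
  rw [← Finset.mul_sum, sum_mul_toEnveloping]
  simp

/-- The `Hᵉ`-linear map out of an induced module attached to an `H`-linear map. -/
noncomputable def desc (ψ : M →ₗ[H] Restricted k H Q) : Induced k H M →ₗ[H ⊗[k] Hᵐᵒᵖ] Q where
  toFun := descHom (Q := Q) ψ.toAddMonoidHom ψ.map_smul
  map_add' := map_add _
  map_smul' := descHom_smul (Q := Q) _ _

theorem desc_tmul_one (ψ : M →ₗ[H] Restricted k H Q) (m : M) : desc ψ (tmul k H m 1) = ψ m :=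
  one_smul (H ⊗[k] Hᵐᵒᵖ) (ψ m : Q)

end Induced

end Induced

section InducedHomological

open scoped ModuleCat.Algebra

noncomputable instance (Q : Type u) [AddCommGroup Q] [Module (H ⊗[k] Hᵐᵒᵖ) Q] :
    Module k (Restricted k H Q) :=
  Module.compHom _ (algebraMap k H)

instance (Q : Type u) [AddCommGroup Q] [Module (H ⊗[k] Hᵐᵒᵖ) Q] :
    IsScalarTower k H (Restricted k H Q) :=
  IsScalarTower.of_algebraMap_smul fun _ _ => rfl

variable {M N L : Type u} [AddCommGroup M] [Module k M] [Module H M] [IsScalarTower k H M]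
  [AddCommGroup N] [Module k N] [Module H N] [IsScalarTower k H N]
  [AddCommGroup L] [Module k L] [Module H L] [IsScalarTower k H L]
  {Q : Type u} [AddCommGroup Q] [Module (H ⊗[k] Hᵐᵒᵖ) Q]

namespace Induced

/-- Induction preserves isomorphisms. -/
noncomputable def congr (e : M ≃ₗ[H] N) : Induced k H M ≃ₗ[H ⊗[k] Hᵐᵒᵖ] Induced k H N :=
  LinearEquiv.ofLinearMap (map e.toLinearMap) (map e.symm.toLinearMap)
    (hom_ext fun m => by simp [map_tmul]) (hom_ext fun m => by simp [map_tmul])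

theorem isShortExact_map {f : M →ₗ[H] N} {g : N →ₗ[H] L} (h : IsShortExact f g) :
    IsShortExact (map (k := k) f) (map (k := k) g) where
  inj := Module.Flat.rTensor_preserves_injective_linearMap (f.restrictScalars k) h.inj
  exact := rTensor_exact H (f := f.restrictScalars k) (g := g.restrictScalars k) h.exact h.surj
  surj := LinearMap.rTensor_surjective H (g := g.restrictScalars k) h.surj

/-- The `H`-linear map attached to an `Hᵉ`-linear map out of an induced module. -/
noncomputable def restrict (φ : Induced k H M →ₗ[H ⊗[k] Hᵐᵒᵖ] Q) : M →ₗ[H] Restricted k H Q :=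
  Restricted.map φ ∘ₗ unit

theorem projective (hM : Module.Projective H M) :
    Module.Projective (H ⊗[k] Hᵐᵒᵖ) (Induced k H M) := by
  obtain ⟨P, g, hP, hg⟩ := exists_projective_cover (H ⊗[k] Hᵐᵒᵖ) (Induced k H M)
  obtain ⟨s, hs⟩ := exists_lift hM (g := Restricted.map g) hg unit
  refine Module.Projective.of_split (desc s) g (hom_ext fun m => ?_)
  rw [LinearMap.comp_apply, desc_tmul_one]
  exact hs m

theorem extendsToProjective_map {f : M →ₗ[H] N} (hf : ExtendsToProjective f) :
    ExtendsToProjective (map (k := k) f) := by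
  intro Q hQ φ
  obtain ⟨ψ, hψ⟩ := hf (ModuleCat.of H (Restricted k H Q)) (Restricted.projective (Q := Q) hQ)
    (restrict (Q := Q) φ)
  refine ⟨desc (Q := Q) ψ, hom_ext fun m => ?_⟩
  rw [LinearMap.comp_apply, map_tmul, desc_tmul_one]
  exact LinearMap.congr_fun hψ m

theorem extendsToProjective_restrict {j : Induced k H M →ₗ[H ⊗[k] Hᵐᵒᵖ] Q}
    (hj : ExtendsToProjective j) : ExtendsToProjective (restrict j) := by
  intro P hP φ
  obtain ⟨ψ, hψ⟩ := hj (ModuleCat.of _ (Induced k H P)) (projective hP) (map φ)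
  refine ⟨augment k ∘ₗ Restricted.map ψ, LinearMap.ext fun m => ?_⟩
  refine (congrArg (augment k) (LinearMap.congr_fun hψ (tmul k H m 1))).trans ?_
  exact (augment_map φ (tmul k H m 1)).trans (congrArg φ (augment_unit m))

theorem extendsToProjective_of_map {f : M →ₗ[H] N} (hf : ExtendsToProjective (map (k := k) f)) :
    ExtendsToProjective f := by
  intro P hP φ
  obtain ⟨ψ, hψ⟩ := extendsToProjective_restrict hf P hP φ
  exact ⟨ψ ∘ₗ unit, hψ⟩

theorem restrict_injective {j : Induced k H M →ₗ[H ⊗[k] Hᵐᵒᵖ] Q} (hj : Function.Injective j) :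
    Function.Injective (restrict j) := fun m m' h => by
  rw [← augment_unit (k := k) (H := H) m, ← augment_unit (k := k) (H := H) m']
  exact congrArg (augment k) (hj h)

variable (k) in
theorem isExtPerp (hM : IsExtPerp H M) : IsExtPerp (H ⊗[k] Hᵐᵒᵖ) (Induced k H M) := by
  obtain ⟨P, g, hP, hg⟩ := exists_projective_cover H M
  have h := isShortExact_ker hg
  exact isExtPerp_of_extends (isShortExact_map h) (projective hP)
    (extendsToProjective_map (hM.extends h))

variable (k) in
theorem isExtPerp_of_induced (hM : IsExtPerp (H ⊗[k] Hᵐᵒᵖ) (Induced k H M)) : IsExtPerp H M := by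
  obtain ⟨P, g, hP, hg⟩ := exists_projective_cover H M
  have h := isShortExact_ker hg
  exact isExtPerp_of_extends h hP (extendsToProjective_of_map (k := k)
    (hM.extends (isShortExact_map h)))

variable (k H) in
theorem isGorensteinClass_induced : IsGorensteinClass (H ⊗[k] Hᵐᵒᵖ) fun N =>
    ∃ M : ModuleCat.{u} H, IsGorensteinProjective H M ∧
      Nonempty (N ≃ₗ[H ⊗[k] Hᵐᵒᵖ] Induced k H M) where
  perp := by
    rintro N ⟨M, hM, ⟨e⟩⟩
    exact (isExtPerp k (isExtPerp_of_isGorensteinProjective hM)).of_retract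
      (i := e.toLinearMap) (r := e.symm.toLinearMap) e.symm_apply_apply
  coresolve := by
    rintro N ⟨M, hM, ⟨e⟩⟩
    obtain ⟨P, L, f, g, hP, h, hL⟩ := exists_coresolution hM
    exact ⟨ModuleCat.of _ (Induced k H P), ModuleCat.of _ (Induced k H L), _, _, projective hP,
      (isShortExact_map h).of_equiv_left e, L, hL, ⟨LinearEquiv.refl _ _⟩⟩
  resolve := by
    rintro N ⟨M, hM, ⟨e⟩⟩
    obtain ⟨K, P, f, g, hP, h, hK⟩ := exists_resolution hM
    exact ⟨ModuleCat.of _ (Induced k H K), ModuleCat.of _ (Induced k H P), _, _, projective hP,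
      (isShortExact_map h).of_equiv_right e.symm, K, hK, ⟨LinearEquiv.refl _ _⟩⟩

variable (k H) in
theorem isGorensteinClass_of_induced : IsGorensteinClass H fun N : ModuleCat.{u} H =>
    IsGorensteinProjective (H ⊗[k] Hᵐᵒᵖ) (Induced k H N) where
  perp N hN := isExtPerp_of_induced k (isExtPerp_of_isGorensteinProjective hN)
  coresolve N hN := by
    obtain ⟨P, L, j, q, hP, h, hL⟩ := exists_coresolution hN
    have hP' := Restricted.projective (k := k) hP
    obtain ⟨C, g, hg⟩ : ∃ (C : ModuleCat.{u} H) (g : Restricted k H P →ₗ[H] C),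
        IsShortExact (restrict j) g :=
      ⟨ModuleCat.of H (Restricted k H P ⧸ LinearMap.range (restrict j)), _,
        isShortExact_mkQ (restrict_injective h.inj)⟩
    have hC : IsExtPerp H C := isExtPerp_of_extends hg hP'
      (extendsToProjective_restrict ((isExtPerp_of_isGorensteinProjective hL).extends h))
    exact ⟨ModuleCat.of H (Restricted k H P), C, restrict (Q := P) j, g, hP', hg,
      isGorensteinProjective_of_mono (isShortExact_map hg) hN
        (isGorensteinProjective_of_projective (projective hP')) (isExtPerp k hC)⟩
  resolve N hN := by
    obtain ⟨P, g, hP, hg⟩ := exists_projective_cover H N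
    obtain ⟨K, f, h⟩ : ∃ (K : ModuleCat.{u} H) (f : K →ₗ[H] P), IsShortExact f g :=
      ⟨ModuleCat.of H (LinearMap.ker g), _, isShortExact_ker hg⟩
    exact ⟨K, P, f, g, hP, h, isGorensteinProjective_of_epi (isShortExact_map h)
      (isGorensteinProjective_of_projective (projective hP)) hN⟩

variable (k) in
theorem isGorensteinProjective_iff :
    IsGorensteinProjective (H ⊗[k] Hᵐᵒᵖ) (Induced k H M) ↔ IsGorensteinProjective H M := by
  obtain ⟨N, ⟨e⟩⟩ : ∃ N : ModuleCat.{u} H, Nonempty (M ≃ₗ[H] N) :=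
    ⟨ModuleCat.of H M, ⟨LinearEquiv.refl H M⟩⟩
  constructor
  · intro h
    exact isGorensteinProjective_of_equiv e
      ((isGorensteinClass_of_induced k H).isGorensteinProjective
      (isGorensteinProjective_of_equiv (congr e.symm) h))
  · intro h
    exact (isGorensteinClass_induced k H).isGorensteinProjective
      (M := ModuleCat.of _ (Induced k H M))
      ⟨N, isGorensteinProjective_of_equiv e.symm h, ⟨congr e⟩⟩

variable (k) in
theorem gProjDimLE_iff (n : ℕ) :
    GProjDimLE (H ⊗[k] Hᵐᵒᵖ) n (Induced k H M) ↔ GProjDimLE H n M := by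
  induction n generalizing M with
  | zero => exact isGorensteinProjective_iff k
  | succ n ih =>
    constructor
    · intro h
      obtain ⟨P, g, hP, hg⟩ := exists_projective_cover H M
      have hs := isShortExact_map (k := k) (isShortExact_ker hg)
      obtain ⟨e⟩ := hs.equiv_ker
      exact gProjDimLE_succ_of_isShortExact n (isShortExact_ker hg)
        (isGorensteinProjective_of_projective hP)
        (ih.1 (gProjDimLE_of_equiv n e (gProjDimLE_ker n h (projective hP) hs.surj)))
    · rintro (h | ⟨G, g, hG, hg, h⟩)
      · exact gProjDimLE_of_isGorensteinProjective _ ((isGorensteinProjective_iff k).2 h)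
      · exact gProjDimLE_succ_of_isShortExact n (isShortExact_map (isShortExact_ker hg))
          ((isGorensteinProjective_iff k).2 hG) (ih.2 h)

end Induced

end InducedHomological

end Hopf

end GorensteinProjective

/-- Let `H` be a Hopf algebra over a field `k` and `H^e = H ⊗[k] Hᵒᵖ` its
enveloping algebra. For a left `H`-module `M`, endow `M ⊗[k] H` with the `H`-bimodule
(i.e. left `H^e`-module) structure `h'(m ⊗ h)h'' = ∑ h'₁ m ⊗ h'₂ h h''`. Then
`Gpd_H(M) = Gpd_{H^e}(M ⊗[k] H)`. -/
theorem gProjDim_eq_gProjDim_enveloping (k : Type u) [Field k]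
    (H : Type u) [Ring H] [HopfAlgebra k H]
    (M : Type u)
    [AddCommGroup M] [Module k M] [Module H M] [IsScalarTower k H M] [SMulCommClass k H M]
    (iE : Module (H ⊗[k] Hᵐᵒᵖ) (M ⊗[k] H))
    (hiE : ∀ (a b : H) (m : M) (x : H),
      modSMul iE (a ⊗ₜ[k] (MulOpposite.op b)) (m ⊗ₜ[k] x) =
        modSMul (tensorModule k H M H) a (m ⊗ₜ[k] (x * b))) :
    gProjDim H M = @gProjDim (H ⊗[k] Hᵐᵒᵖ) _ (M ⊗[k] H) _ iE := by
  have hadd : ∀ (s t : H ⊗[k] Hᵐᵒᵖ) (y : M ⊗[k] H),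
      modSMul iE (s + t) y = modSMul iE s y + modSMul iE t y := iE.add_smul
  have hzero : ∀ y : M ⊗[k] H, modSMul iE 0 y = 0 := iE.zero_smul
  have hsmul : ∀ (s : H ⊗[k] Hᵐᵒᵖ) (x y : M ⊗[k] H),
      modSMul iE s (x + y) = modSMul iE s x + modSMul iE s y := iE.smul_add
  have hsmul0 : ∀ s : H ⊗[k] Hᵐᵒᵖ, modSMul iE s (0 : M ⊗[k] H) = 0 := iE.smul_zero
  have key : ∀ (s : H ⊗[k] Hᵐᵒᵖ) (t : M ⊗[k] H),
      modSMul iE s t = GorensteinProjective.envelopingRep k H M s t := by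
    intro s t
    induction s with
    | zero => rw [map_zero]; exact hzero t
    | add s s' hs hs' => rw [map_add, hadd, hs, hs', LinearMap.add_apply]
    | tmul a b =>
      induction t with
      | zero => rw [hsmul0, map_zero]
      | add x y hx hy => rw [hsmul, hx, hy, map_add]
      | tmul m x => exact hiE a b.unop m x
  let e : @LinearEquiv _ _ _ _ (RingHom.id (H ⊗[k] Hᵐᵒᵖ)) (RingHom.id _) _ _
      (M ⊗[k] H) (GorensteinProjective.Induced k H M) _ _ iE _ :=
    letI := iE
    { AddEquiv.refl (M ⊗[k] H) with map_smul' := key }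
  have h (n : ℕ) : @GProjDimLE (H ⊗[k] Hᵐᵒᵖ) _ n (M ⊗[k] H) _ iE ↔ GProjDimLE H n M :=
    letI := iE
    Iff.trans ⟨GorensteinProjective.gProjDimLE_of_equiv n e.symm,
      GorensteinProjective.gProjDimLE_of_equiv n e⟩
      (GorensteinProjective.Induced.gProjDimLE_iff k n)
  simp only [gProjDim, h]
end
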